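/- Let A and B be the explicit 7×7 integer matrices given in the context. For every strong shift equivalence over ℤ from A to B, given by elementary strong shift equivalences (R₁,S₁), …, (R_k,S_k), the sum Σ_{i=1}^{k} sgc₂(Rᵢ,Sᵢ) equals 1 in ℤ/2ℤ. -/

import Mathlib

/-- The sign-gyration polynomial `sgc₂` of a pair `(R, S)` of rectangular
integer matrices, with values in `ℤ/2ℤ`. -/
def sgc2 {n p : ℕ} (R : Matrix (Fin n) (Fin p) ℤ) (S : Matrix (Fin p) (Fin n) ℤ) : ZMod 2 :=
  (((∑ i : Fin n, ∑ j : Fin n, ∑ k : Fin p, ∑ l : Fin p,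
      if i < j ∧ l < k then R i k * S k i * R j l * S l j else 0)
    + (∑ i : Fin n, ∑ j : Fin n, ∑ k : Fin p, ∑ l : Fin p,
      if i < j ∧ l ≤ k then R i k * S k j * R j l * S l i else 0)
    + (∑ i : Fin n, ∑ k : Fin p, (R i k * (R i k - 1)) / 2 * (S k i) ^ 2) : ℤ) : ZMod 2)

/-- A strong shift equivalence (chain of elementary strong shift equivalences)
over a semiring `Λ`, consisting of `k` elementary steps. -/
structure SSEChain (Λ : Type) [Semiring Λ] (k : ℕ) where
  size : Fin (k + 1) → ℕ
  mat : ∀ i : Fin (k + 1), Matrix (Fin (size i)) (Fin (size i)) Λ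
  R : ∀ i : Fin k, Matrix (Fin (size i.castSucc)) (Fin (size i.succ)) Λ
  S : ∀ i : Fin k, Matrix (Fin (size i.succ)) (Fin (size i.castSucc)) Λ
  hR : ∀ i : Fin k, mat i.castSucc = R i * S i
  hS : ∀ i : Fin k, mat i.succ = S i * R i

/-- The chain `c` is a strong shift equivalence from `A` to `B`. -/
def SSEChain.From {Λ : Type} [Semiring Λ] {k n m : ℕ} (c : SSEChain Λ k)
    (A : Matrix (Fin n) (Fin n) Λ) (B : Matrix (Fin m) (Fin m) Λ) : Prop :=
  ∃ (h0 : c.size 0 = n) (h1 : c.size (Fin.last k) = m),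
    Matrix.reindex (finCongr h0) (finCongr h0) (c.mat 0) = A ∧
    Matrix.reindex (finCongr h1) (finCongr h1) (c.mat (Fin.last k)) = B

def Amat : Matrix (Fin 7) (Fin 7) ℤ :=
  !![0,0,1,1,3,0,0; 1,0,0,0,3,0,0; 0,1,0,0,3,0,0; 0,0,1,0,3,0,0;
     0,0,0,0,0,0,1; 1,1,1,1,10,0,0; 1,1,1,1,0,1,0]

def Bmat : Matrix (Fin 7) (Fin 7) ℤ :=
  !![0,0,1,1,3,0,0; 1,0,0,0,0,0,0; 0,1,0,0,0,0,0; 0,0,1,0,0,0,0;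
     0,0,0,0,0,0,1; 4,5,6,3,10,0,0; 4,5,6,3,0,1,0]

section Cocycle

/-- The binomial coefficient `x choose 2` modulo `2`. -/
def choose2 (x : ℤ) : ZMod 2 := ((x * (x - 1) / 2 : ℤ) : ZMod 2)

lemma two_mul_half_mul_pred (x : ℤ) : 2 * (x * (x - 1) / 2) = x * (x - 1) :=
  Int.mul_ediv_cancel' (by
    rcases Int.even_or_odd x with h | h
    · exact (h.two_dvd).mul_right _
    · exact ((h.sub_odd odd_one).two_dvd).mul_left _)

lemma choose2_add (x y : ℤ) : choose2 (x + y) = choose2 x + choose2 y + x * y := by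
  have : (x + y) * (x + y - 1) / 2 = x * (x - 1) / 2 + y * (y - 1) / 2 + x * y := by
    have := two_mul_half_mul_pred x
    have := two_mul_half_mul_pred y
    have := two_mul_half_mul_pred (x + y)
    linarith
  simp [choose2, this]

lemma choose2_zero : choose2 0 = 0 := by simp [choose2]

lemma ZMod2.sq (x : ZMod 2) : x ^ 2 = x := by revert x; decide

lemma choose2_mul (x y : ℤ) : choose2 (x * y) = x * choose2 y + y * choose2 x := by
  have : x * y * (x * y - 1) / 2 = x ^ 2 * (y * (y - 1) / 2) + y * (x * (x - 1) / 2) := by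
    have h1 := two_mul_half_mul_pred x
    have h2 := two_mul_half_mul_pred y
    have h3 := two_mul_half_mul_pred (x * y)
    have : 2 * (x * y * (x * y - 1) / 2) =
        2 * (x ^ 2 * (y * (y - 1) / 2) + y * (x * (x - 1) / 2)) := by
      linear_combination h3 - x ^ 2 * h2 - y * h1
    linarith
  simp only [choose2, this]
  push_cast
  rw [ZMod2.sq]

lemma choose2_sum {p : ℕ} (f : Fin p → ℤ) :
    choose2 (∑ u, f u) =
      ∑ u, choose2 (f u) + ∑ u, ∑ v, if u < v then (f u * f v : ZMod 2) else 0 := by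
  induction p with
  | zero => simp [choose2_zero]
  | succ p ih =>
    rw [Fin.sum_univ_succ, choose2_add, ih]
    simp only [Fin.sum_univ_succ, Fin.succ_lt_succ_iff, Fin.succ_pos, if_true, if_false,
      Fin.not_lt_zero, Int.cast_sum, Finset.mul_sum]
    ring

lemma sgc2_eq {n p : ℕ} (R : Matrix (Fin n) (Fin p) ℤ) (S : Matrix (Fin p) (Fin n) ℤ) :
    sgc2 R S =
      (∑ i, ∑ j, ∑ k, ∑ l,
        if i < j ∧ l < k then (R i k * S k i * R j l * S l j : ZMod 2) else 0)
      + (∑ i, ∑ j, ∑ k, ∑ l,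
        if i < j ∧ l ≤ k then (R i k * S k j * R j l * S l i : ZMod 2) else 0)
      + ∑ i, ∑ k, choose2 (R i k) * S k i := by
  unfold sgc2 choose2
  push_cast
  simp only [ZMod2.sq]

lemma sum_comm_pairs {α β M : Type*} [Fintype α] [Fintype β] [AddCommMonoid M]
    (F : α → α → β → β → M) :
    ∑ k, ∑ l, ∑ u, ∑ v, F k l u v = ∑ u, ∑ v, ∑ k, ∑ l, F k l u v := by
  calc _ = ∑ x : α × α, ∑ y : β × β, F x.1 x.2 y.1 y.2 := by simp only [Fintype.sum_prod_type]
    _ = ∑ y : β × β, ∑ x : α × α, F x.1 x.2 y.1 y.2 := Finset.sum_comm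
    _ = _ := by simp only [Fintype.sum_prod_type]

lemma ite_mul_sum_mul_sum {α : Type*} [Fintype α] (P : Prop) [Decidable P] (x y : ZMod 2)
    (f g : α → ZMod 2) :
    (if P then x * (∑ u, f u) * y * (∑ v, g v) else 0) =
      ∑ u, ∑ v, if P then x * f u * y * g v else 0 := by
  split_ifs <;> simp [Finset.mul_sum, Finset.sum_mul]
  rw [Finset.sum_comm]

lemma ite_sum_mul_sum_mul {α : Type*} [Fintype α] (P : Prop) [Decidable P] (x y : ZMod 2)
    (f g : α → ZMod 2) :
    (if P then (∑ u, f u) * x * (∑ v, g v) * y else 0) =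
      ∑ u, ∑ v, if P then f u * x * g v * y else 0 := by
  split_ifs <;> simp [Finset.mul_sum, Finset.sum_mul]
  rw [Finset.sum_comm]

lemma cocycle_pointwise {n p q : ℕ} (a : Fin n → Fin p → ZMod 2) (b : Fin p → Fin q → ZMod 2)
    (c : Fin q → Fin n → ZMod 2) (i j : Fin n) (u v : Fin p) (k l : Fin q) :
    ((if i < j ∧ v < u then a i u * (b u k * c k i) * a j v * (b v l * c l j) else 0)
    + (if i < j ∧ v ≤ u then a i u * (b u k * c k j) * a j v * (b v l * c l i) else 0)
    + (if u < v ∧ l < k then b u k * (c k i * a i u) * b v l * (c l j * a j v) else 0)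
    + (if u < v ∧ l ≤ k then b u k * (c k j * a j v) * b v l * (c l i * a i u) else 0)
    + (if i < j ∧ l < k then a i u * b u k * c k i * (a j v * b v l) * c l j else 0)
    + (if i < j ∧ l ≤ k then a i u * b u k * c k j * (a j v * b v l) * c l i else 0)
    + (if i = j ∧ k = l ∧ u < v then a i u * b u k * (a i v * b v k) * c k i else 0))
    + ((if j < i ∧ u < v ∧ l < k then a i u * b u k * c k i * (a j v * b v l * c l j) else 0)
      + (if i < j ∧ v < u ∧ k < l then a j v * b v l * c l j * (a i u * b u k * c k i) else 0))
    + ((if j < i ∧ u < v ∧ l ≤ k then a i u * b u k * c k j * (a j v * b v l * c l i) else 0)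
      + (if i < j ∧ v < u ∧ k ≤ l then a j v * b v l * c l i * (a i u * b u k * c k j) else 0))
    + ((if i < j ∧ u = v ∧ l < k then a i u * b u k * c k i * (a j v * b v l * c l j) else 0)
      + (if i < j ∧ u = v ∧ k < l then a i u * b u l * c l i * (a j v * b v k * c k j) else 0))
    = 0 := by
  rcases lt_trichotomy i j with h | h | h <;> rcases lt_trichotomy u v with h1 | h1 | h1 <;>
  rcases lt_trichotomy k l with h2 | h2 | h2 <;>
  (try subst h) <;> (try subst h1) <;> (try subst h2) <;>
  simp_all [ne_of_lt, ne_of_gt, le_of_lt, not_lt_of_gt, not_le_of_gt] <;>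
  (try ring_nf) <;> (try reduce_mod_char) <;>
  simp [CharTwo.add_self_eq_zero]

lemma sum_swap_pairs {α β γ M : Type*} [Fintype α] [Fintype β] [Fintype γ] [AddCommMonoid M]
    (F : α → α → β → β → γ → γ → M) :
    ∑ i, ∑ j, ∑ u, ∑ v, ∑ k, ∑ l, F j i v u l k = ∑ i, ∑ j, ∑ u, ∑ v, ∑ k, ∑ l, F i j u v k l := by
  rw [Finset.sum_comm]
  refine Finset.sum_congr rfl fun i _ => Finset.sum_congr rfl fun j _ => ?_
  rw [Finset.sum_comm]
  refine Finset.sum_congr rfl fun u _ => Finset.sum_congr rfl fun v _ => ?_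
  rw [Finset.sum_comm]

lemma sum_choose2_mul {n p q : ℕ} (a : Matrix (Fin n) (Fin p) ℤ) (b : Matrix (Fin p) (Fin q) ℤ)
    (c : Matrix (Fin q) (Fin n) ℤ) :
    ∑ i, ∑ k, choose2 ((a * b) i k) * (c k i : ZMod 2) =
      ∑ i, ∑ u, choose2 (a i u) * ∑ k, (b u k * c k i : ZMod 2)
      + ∑ u, ∑ k, choose2 (b u k) * ∑ i, (c k i * a i u : ZMod 2)
      + ∑ i, ∑ j, ∑ u, ∑ v, ∑ k, ∑ l,
        if i = j ∧ k = l ∧ u < v then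
          (a i u * b u k * (a i v * b v k) * c k i : ZMod 2) else 0 := by
  have h1 : ∑ i, ∑ j, ∑ u, ∑ v, ∑ k, ∑ l, (if i = j ∧ k = l ∧ u < v then
        (a i u * b u k * (a i v * b v k) * c k i : ZMod 2) else 0) =
      ∑ i, ∑ k, ∑ u, ∑ v, if u < v then
        (a i u * b u k * (a i v * b v k) * c k i : ZMod 2) else 0 := by
    refine Finset.sum_congr rfl fun i _ => ?_
    rw [Finset.sum_eq_single i (by intro j _ hj; simp [hj.symm]) (by simp)]
    have (u v : Fin p) (k : Fin q) : (∑ l, if i = i ∧ k = l ∧ u < v then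
        (a i u * b u k * (a i v * b v k) * c k i : ZMod 2) else 0) =
        if u < v then (a i u * b u k * (a i v * b v k) * c k i : ZMod 2) else 0 := by
      rw [Finset.sum_eq_single k (by intro l _ hl; simp [hl.symm]) (by simp)]
      simp
    calc _ = ∑ u, ∑ v, ∑ k, (if u < v then
          (a i u * b u k * (a i v * b v k) * c k i : ZMod 2) else 0) :=
        Finset.sum_congr rfl fun u _ => Finset.sum_congr rfl fun v _ =>
          Finset.sum_congr rfl fun k _ => this u v k
      _ = ∑ u, ∑ k, ∑ v, (if u < v then
          (a i u * b u k * (a i v * b v k) * c k i : ZMod 2) else 0) :=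
        Finset.sum_congr rfl fun u _ => Finset.sum_comm
      _ = _ := Finset.sum_comm
  have h2 : ∑ u, ∑ k, choose2 (b u k) * ∑ i, (c k i * a i u : ZMod 2) =
      ∑ i, ∑ k, ∑ u, a i u * choose2 (b u k) * c k i := by
    simp only [Finset.mul_sum]
    calc _ = ∑ u, ∑ i, ∑ k, choose2 (b u k) * (c k i * a i u : ZMod 2) :=
          Finset.sum_congr rfl fun u _ => Finset.sum_comm
      _ = ∑ i, ∑ u, ∑ k, choose2 (b u k) * (c k i * a i u : ZMod 2) := Finset.sum_comm
      _ = ∑ i, ∑ k, ∑ u, choose2 (b u k) * (c k i * a i u : ZMod 2) :=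
          Finset.sum_congr rfl fun u _ => Finset.sum_comm
      _ = _ := by
          refine Finset.sum_congr rfl fun i _ => Finset.sum_congr rfl fun k _ =>
            Finset.sum_congr rfl fun u _ => by ring
  have h3 : ∑ i, ∑ u, choose2 (a i u) * ∑ k, (b u k * c k i : ZMod 2) =
      ∑ i, ∑ k, ∑ u, b u k * choose2 (a i u) * c k i := by
    simp only [Finset.mul_sum]
    refine Finset.sum_congr rfl fun i _ => ?_
    rw [Finset.sum_comm]
    refine Finset.sum_congr rfl fun k _ => Finset.sum_congr rfl fun u _ => by ring
  rw [h1, h2, h3, ← Finset.sum_add_distrib, ← Finset.sum_add_distrib]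
  refine Finset.sum_congr rfl fun i _ => ?_
  rw [← Finset.sum_add_distrib, ← Finset.sum_add_distrib]
  refine Finset.sum_congr rfl fun k _ => ?_
  rw [Matrix.mul_apply, choose2_sum, add_mul]
  simp only [choose2_mul, Finset.sum_mul, Finset.sum_add_distrib, add_mul, ite_mul, zero_mul]
  push_cast
  ring

lemma sgc2_left {n p q : ℕ} (a : Matrix (Fin n) (Fin p) ℤ) (b : Matrix (Fin p) (Fin q) ℤ)
    (c : Matrix (Fin q) (Fin n) ℤ) :
    sgc2 a (b * c) =
      (∑ i, ∑ j, ∑ u, ∑ v, ∑ k, ∑ l, if i < j ∧ v < u then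
        (a i u * (b u k * c k i) * a j v * (b v l * c l j) : ZMod 2) else 0)
      + (∑ i, ∑ j, ∑ u, ∑ v, ∑ k, ∑ l, if i < j ∧ v ≤ u then
        (a i u * (b u k * c k j) * a j v * (b v l * c l i) : ZMod 2) else 0)
      + ∑ i, ∑ u, choose2 (a i u) * ∑ k, (b u k * c k i : ZMod 2) := by
  have h (u i) : ((b * c) u i : ZMod 2) = ∑ k, (b u k * c k i : ZMod 2) := by
    simp [Matrix.mul_apply]
  simp only [sgc2_eq, h]
  congr 2 <;>
  exact Finset.sum_congr rfl fun i _ => Finset.sum_congr rfl fun j _ =>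
    Finset.sum_congr rfl fun u _ => Finset.sum_congr rfl fun v _ => ite_mul_sum_mul_sum _ _ _ _ _

lemma sgc2_right {n p q : ℕ} (a : Matrix (Fin n) (Fin p) ℤ) (b : Matrix (Fin p) (Fin q) ℤ)
    (c : Matrix (Fin q) (Fin n) ℤ) :
    sgc2 b (c * a) =
      (∑ i, ∑ j, ∑ u, ∑ v, ∑ k, ∑ l, if u < v ∧ l < k then
        (b u k * (c k i * a i u) * b v l * (c l j * a j v) : ZMod 2) else 0)
      + (∑ i, ∑ j, ∑ u, ∑ v, ∑ k, ∑ l, if u < v ∧ l ≤ k then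
        (b u k * (c k j * a j v) * b v l * (c l i * a i u) : ZMod 2) else 0)
      + ∑ u, ∑ k, choose2 (b u k) * ∑ i, (c k i * a i u : ZMod 2) := by
  rw [sgc2_left]
  congr 2
  · rw [sum_comm_pairs (fun i j u v => ∑ k, ∑ l, if u < v ∧ l < k then
        (b u k * (c k i * a i u) * b v l * (c l j * a j v) : ZMod 2) else 0)]
    exact Finset.sum_congr rfl fun u _ => Finset.sum_congr rfl fun v _ => sum_comm_pairs _
  · rw [sum_comm_pairs (fun i j u v => ∑ k, ∑ l, if u < v ∧ l ≤ k then
        (b u k * (c k j * a j v) * b v l * (c l i * a i u) : ZMod 2) else 0)]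
    refine Finset.sum_congr rfl fun u _ => Finset.sum_congr rfl fun v _ => ?_
    rw [sum_comm_pairs]
    exact Finset.sum_comm

lemma sgc2_mul {n p q : ℕ} (a : Matrix (Fin n) (Fin p) ℤ) (b : Matrix (Fin p) (Fin q) ℤ)
    (c : Matrix (Fin q) (Fin n) ℤ) :
    sgc2 (a * b) c =
      (∑ i, ∑ j, ∑ u, ∑ v, ∑ k, ∑ l, if i < j ∧ l < k then
        (a i u * b u k * c k i * (a j v * b v l) * c l j : ZMod 2) else 0)
      + (∑ i, ∑ j, ∑ u, ∑ v, ∑ k, ∑ l, if i < j ∧ l ≤ k then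
        (a i u * b u k * c k j * (a j v * b v l) * c l i : ZMod 2) else 0)
      + ∑ i, ∑ k, choose2 ((a * b) i k) * (c k i : ZMod 2) := by
  have h (i k) : ((a * b) i k : ZMod 2) = ∑ u, (a i u * b u k : ZMod 2) := by
    simp [Matrix.mul_apply]
  rw [sgc2_eq]
  congr 2 <;>
  refine Finset.sum_congr rfl fun i _ => Finset.sum_congr rfl fun j _ => ?_ <;>
  rw [← sum_comm_pairs] <;>
  refine Finset.sum_congr rfl fun k _ => Finset.sum_congr rfl fun l _ => ?_ <;>
  rw [h, h] <;>
  exact ite_sum_mul_sum_mul _ _ _ _ _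

lemma sgc2_cocycle {n p q : ℕ} (a : Matrix (Fin n) (Fin p) ℤ) (b : Matrix (Fin p) (Fin q) ℤ)
    (c : Matrix (Fin q) (Fin n) ℤ) :
    sgc2 a (b * c) + sgc2 b (c * a) = sgc2 (a * b) c := by
  rw [← CharTwo.add_eq_zero]
  have key := Finset.sum_eq_zero
    (s := (Finset.univ : Finset (Fin n × Fin n × Fin p × Fin p × Fin q × Fin q))) fun x _ =>
      cocycle_pointwise (fun i u => (a i u : ZMod 2)) (fun u k => (b u k : ZMod 2))
        (fun k i => (c k i : ZMod 2)) x.1 x.2.1 x.2.2.1 x.2.2.2.1 x.2.2.2.2.1 x.2.2.2.2.2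
  simp only [Finset.sum_add_distrib] at key
  simp only [Fintype.sum_prod_type] at key
  rw [sum_swap_pairs (fun i j u v k l => if j < i ∧ u < v ∧ l < k then
      (a i u * b u k * c k i * (a j v * b v l * c l j) : ZMod 2) else 0),
    sum_swap_pairs (fun i j u v k l => if j < i ∧ u < v ∧ l ≤ k then
      (a i u * b u k * c k j * (a j v * b v l * c l i) : ZMod 2) else 0)] at key
  have h (i j u v) : (∑ k, ∑ l, if i < j ∧ u = v ∧ k < l then
      (a i u * b u l * c l i * (a j v * b v k * c k j) : ZMod 2) else 0) =
      ∑ k, ∑ l, if i < j ∧ u = v ∧ l < k then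
        (a i u * b u k * c k i * (a j v * b v l * c l j) : ZMod 2) else 0 := Finset.sum_comm
  simp only [h, CharTwo.add_self_eq_zero, add_zero] at key
  rw [sgc2_left, sgc2_right, sgc2_mul, sum_choose2_mul]
  generalize ∑ i, ∑ u, choose2 (a i u) * ∑ k, (b u k * c k i : ZMod 2) = X
  generalize ∑ u, ∑ k, choose2 (b u k) * ∑ i, (c k i * a i u : ZMod 2) = Y
  linear_combination key + CharTwo.add_self_eq_zero X + CharTwo.add_self_eq_zero Y

end Cocycle

section Reduction

open Matrix

lemma sgc2_zero_left {n p : ℕ} (S : Matrix (Fin p) (Fin n) ℤ) : sgc2 0 S = 0 := by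
  simp [sgc2_eq, choose2_zero]

lemma sgc2_zero_right {n p : ℕ} (R : Matrix (Fin n) (Fin p) ℤ) : sgc2 R 0 = 0 := by
  simp [sgc2_eq]

lemma sgc2_one_left {n : ℕ} (S : Matrix (Fin n) (Fin n) ℤ) : sgc2 1 S = 0 := by
  have := sgc2_cocycle (1 : Matrix (Fin n) (Fin n) ℤ) 1 S
  simpa using this

/-- The behaviour of `sgc2` under a change of basis on both sides. -/
lemma sgc2_conj {n p n' p' : ℕ} (R : Matrix (Fin n) (Fin p) ℤ) (S : Matrix (Fin p) (Fin n) ℤ)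
    {G : Matrix (Fin n) (Fin n') ℤ} {H : Matrix (Fin n') (Fin n) ℤ}
    {G' : Matrix (Fin p) (Fin p') ℤ} {H' : Matrix (Fin p') (Fin p) ℤ}
    (hGH : G * H = 1) (hGH' : G' * H' = 1) :
    sgc2 R S = sgc2 (H * R * G') (H' * S * G) + sgc2 G (H * (R * S)) +
      sgc2 G' (H' * (S * R)) := by
  have h1 := sgc2_cocycle G (H * R) S
  have h2 := sgc2_cocycle (H * R * G') H' (S * G)
  have h3 := sgc2_cocycle G' H' (S * R)
  have e1 : G * (H * R) = R := by rw [← Matrix.mul_assoc, hGH, Matrix.one_mul]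
  have e2 : H * R * G' * H' = H * R := by rw [Matrix.mul_assoc, hGH', Matrix.mul_one]
  have e3 : S * G * (H * R * G') = S * R * G' := by
    rw [show S * G * (H * R * G') = S * (G * H) * R * G' by simp only [Matrix.mul_assoc], hGH,
      Matrix.mul_one]
  rw [e1, Matrix.mul_assoc] at h1
  rw [e2, e3, ← Matrix.mul_assoc] at h2
  rw [hGH', sgc2_one_left] at h3
  rw [← h1, ← h2, CharTwo.add_eq_zero.mp h3]
  ring

/-- Every integer matrix factors through its (free) range. -/
lemma exists_injective_mul_split {p n : ℕ} (C : Matrix (Fin p) (Fin n) ℤ) :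
    ∃ (r : ℕ) (P : Matrix (Fin p) (Fin r) ℤ) (Q : Matrix (Fin r) (Fin n) ℤ)
      (J : Matrix (Fin n) (Fin r) ℤ), C = P * Q ∧ Q * J = 1 ∧
      ∀ (l : ℕ) (X : Matrix (Fin r) (Fin l) ℤ), P * X = 0 → X = 0 := by
  obtain ⟨r, ⟨b⟩⟩ := Submodule.nonempty_basis_of_pid (Pi.basisFun ℤ (Fin p))
    (LinearMap.range C.mulVecLin)
  choose g hg using fun j => (b j).2
  let P : Matrix (Fin p) (Fin r) ℤ := Matrix.of fun i j => (b j : Fin p → ℤ) i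
  let Q : Matrix (Fin r) (Fin n) ℤ :=
    Matrix.of fun j k => b.repr (C.mulVecLin.rangeRestrict (Pi.single k 1)) j
  let J : Matrix (Fin n) (Fin r) ℤ := Matrix.of fun k j => g j k
  have hP : ∀ (l : ℕ) (X : Matrix (Fin r) (Fin l) ℤ), P * X = 0 → X = 0 := by
    intro l X hX
    ext j k
    have hli := Fintype.linearIndependent_iff.mp b.linearIndependent (fun j => X j k)
    refine hli ?_ j
    ext i
    have := congr_fun (congr_fun hX i) k
    simpa [Matrix.mul_apply, P, mul_comm] using this
  have hC : C = P * Q := by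
    ext i k
    have hk : (C.mulVecLin.rangeRestrict (Pi.single k 1) : Fin p → ℤ) i = C i k := by simp
    have := congr_fun (congr_arg Subtype.val
      (b.sum_repr (C.mulVecLin.rangeRestrict (Pi.single k 1)))) i
    rw [hk] at this
    rw [← this]
    simp only [Matrix.mul_apply, P, Q, Matrix.of_apply, Submodule.coe_sum, Submodule.coe_smul,
      Finset.sum_apply, Pi.smul_apply, smul_eq_mul, mul_comm]
  have hJ : C * J = P := by
    ext i j
    exact congr_fun (hg j) i
  refine ⟨r, P, Q, J, hC, ?_, hP⟩
  refine sub_eq_zero.mp (hP _ _ ?_)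
  rw [Matrix.mul_sub, ← Matrix.mul_assoc, ← hC, hJ, Matrix.mul_one, sub_self]

lemma sgc2_eq_zero_of_mul_eq_zero {n p : ℕ} (R : Matrix (Fin n) (Fin p) ℤ)
    (S : Matrix (Fin p) (Fin n) ℤ) (hRS : R * S = 0) (hSR : S * R = 0) : sgc2 R S = 0 := by
  obtain ⟨s, P, Q, J, rfl, hQJ, hP⟩ := exists_injective_mul_split S
  have h1 : R * P = 0 := by
    rw [← Matrix.mul_one (R * P), ← hQJ, ← Matrix.mul_assoc, Matrix.mul_assoc R, hRS,
      Matrix.zero_mul]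
  have h2 : Q * R = 0 := hP _ _ (by rw [← Matrix.mul_assoc, hSR])
  have h3 := sgc2_cocycle P Q R
  rw [h1, h2, sgc2_zero_right, sgc2_zero_right, add_zero] at h3
  have h4 := sgc2_cocycle R (P * Q) 1
  rwa [Matrix.one_mul, Matrix.mul_one, ← h3, hRS, sgc2_zero_left, add_zero] at h4

lemma Fin.natAdd_lt_castAdd_iff_false {m r : ℕ} (i : Fin r) (j : Fin m) :
    ¬ Fin.natAdd m i < Fin.castAdd r j := by
  simp only [Fin.lt_def, Fin.val_natAdd, Fin.val_castAdd]; omega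

/-- Additivity of `sgc2` for block upper triangular pairs. -/
lemma sgc2_block {m r m' r' : ℕ} (R : Matrix (Fin (m + r)) (Fin (m' + r')) ℤ)
    (S : Matrix (Fin (m' + r')) (Fin (m + r)) ℤ)
    (hR : ∀ i j, R (Fin.natAdd m i) (Fin.castAdd r' j) = 0)
    (hS : ∀ i j, S (Fin.natAdd m' i) (Fin.castAdd r j) = 0) :
    sgc2 R S =
      sgc2 (R.submatrix (Fin.castAdd r) (Fin.castAdd r'))
        (S.submatrix (Fin.castAdd r') (Fin.castAdd r)) +
      sgc2 (R.submatrix (Fin.natAdd m) (Fin.natAdd m'))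
        (S.submatrix (Fin.natAdd m') (Fin.natAdd m)) := by
  have hlt {a b : ℕ} (i j : Fin a) : Fin.castAdd b i < Fin.castAdd b j ↔ i < j := Iff.rfl
  have hle {a b : ℕ} (i j : Fin a) : Fin.castAdd b i ≤ Fin.castAdd b j ↔ i ≤ j := Iff.rfl
  simp only [sgc2_eq, Fin.sum_univ_add, hR, hS, Fin.natAdd_lt_castAdd_iff_false,
    Int.cast_zero, mul_zero, zero_mul, ite_self, Finset.sum_const_zero, add_zero, zero_add,
    false_and, and_false, if_false, choose2_zero, Matrix.submatrix_apply,
    Fin.natAdd_lt_natAdd_iff, hlt, Fin.natAdd_le_natAdd_iff,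
    hle]
  ring

/-- A splitting of `ℤⁿ` as the kernel of `C` (embedded by `K`, with retraction `L`) and a
complement mapped isomorphically by `Q` to `ℤʳ` (with section `J`). -/
structure KernelSplitting {n : ℕ} (C : Matrix (Fin n) (Fin n) ℤ) where
  m : ℕ
  r : ℕ
  K : Matrix (Fin n) (Fin m) ℤ
  L : Matrix (Fin m) (Fin n) ℤ
  J : Matrix (Fin n) (Fin r) ℤ
  Q : Matrix (Fin r) (Fin n) ℤ
  mul_K : C * K = 0
  L_mul_K : L * K = 1
  Q_mul_J : Q * J = 1
  Q_mul_K : Q * K = 0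
  L_mul_J : L * J = 0
  sum_eq_one : K * L + J * Q = 1
  Q_mul_eq_zero : ∀ (l : ℕ) (X : Matrix (Fin n) (Fin l) ℤ), C * X = 0 → Q * X = 0

lemma nonempty_kernelSplitting {n : ℕ} (C : Matrix (Fin n) (Fin n) ℤ) :
    Nonempty (KernelSplitting C) := by
  obtain ⟨r, P, Q, J, hC, hQJ, hP⟩ := exists_injective_mul_split C
  obtain ⟨m, K, L, M, hKL, hLM, hK⟩ := exists_injective_mul_split (1 - J * Q)
  have cancel {l : ℕ} (X : Matrix (Fin l) (Fin m) ℤ) (h : X * L = 0) : X = 0 := by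
    rw [← Matrix.mul_one X, ← hLM, ← Matrix.mul_assoc, h, Matrix.zero_mul]
  have h1 : Q * (1 - J * Q) = 0 := by
    rw [Matrix.mul_sub, ← Matrix.mul_assoc, hQJ, Matrix.mul_one, Matrix.one_mul, sub_self]
  have h2 : (1 - J * Q) * J = 0 := by
    rw [Matrix.sub_mul, Matrix.mul_assoc, hQJ, Matrix.mul_one, Matrix.one_mul, sub_self]
  have hQK : Q * K = 0 := cancel _ (by rw [Matrix.mul_assoc, ← hKL, h1])
  have hLJ : L * J = 0 := hK _ _ (by rw [← Matrix.mul_assoc, ← hKL, h2])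
  have hJQ : K * L + J * Q = 1 := by rw [← hKL, sub_add_cancel]
  refine ⟨⟨m, r, K, L, J, Q, ?_, ?_, hQJ, hQK, hLJ, hJQ, ?_⟩⟩
  · rw [hC, Matrix.mul_assoc, hQK, Matrix.mul_zero]
  · refine sub_eq_zero.mp (hK _ _ ?_)
    rw [Matrix.mul_sub, ← Matrix.mul_assoc, ← hKL, Matrix.sub_mul, Matrix.mul_assoc, hQK,
      Matrix.mul_zero, Matrix.one_mul, Matrix.mul_one, sub_zero, sub_self]
  · intro l X hX
    exact hP _ _ (by rw [← Matrix.mul_assoc, ← hC, hX])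

/-- A chosen kernel splitting. -/
noncomputable def kernelSplitting {n : ℕ} (C : Matrix (Fin n) (Fin n) ℤ) : KernelSplitting C :=
  (nonempty_kernelSplitting C).some

namespace KernelSplitting

variable {n : ℕ} {C : Matrix (Fin n) (Fin n) ℤ} (s : KernelSplitting C)

lemma r_le : s.r ≤ n := by
  have hinj : Function.Injective s.J.mulVecLin := by
    rw [injective_iff_map_eq_zero]
    intro x hx
    have : (s.Q * s.J) *ᵥ x = 0 := by
      rw [← Matrix.mulVec_mulVec]
      simpa using congr_arg (s.Q *ᵥ ·) hx
    simpa [s.Q_mul_J] using this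
  simpa using card_le_of_injective ℤ s.J.mulVecLin hinj

lemma J_mul_Q_of_r_eq (h : s.r = n) : s.J * s.Q = 1 := by
  have := s.Q_mul_J
  generalize s.Q = Q at *
  generalize s.J = J at *
  revert Q J
  rw [h]
  intro Q J h
  exact mul_eq_one_comm.mp h

lemma eq_zero_of_mul_eq_zero (h : s.J * s.Q = 1) {l : ℕ} (X : Matrix (Fin n) (Fin l) ℤ)
    (hX : C * X = 0) : X = 0 := by
  rw [← Matrix.one_mul X, ← h, Matrix.mul_assoc, s.Q_mul_eq_zero _ _ hX, Matrix.mul_zero]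

lemma J_mul_Q_of_isUnit (h : IsUnit C) : s.J * s.Q = 1 := by
  obtain ⟨D, hD⟩ := h.exists_left_inv
  have : s.K = 0 := by
    rw [← Matrix.one_mul s.K, ← hD, Matrix.mul_assoc, s.mul_K, Matrix.mul_zero]
  simpa [this] using s.sum_eq_one

/-- The matrix induced on the complement of the kernel. -/
def core : Matrix (Fin s.r) (Fin s.r) ℤ := s.Q * C * s.J

/-- The change of basis adapted to the splitting. -/
def basis : Matrix (Fin n) (Fin (s.m + s.r)) ℤ :=
  Matrix.of fun i => Fin.append (s.K i) (s.J i)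

/-- The inverse of `KernelSplitting.basis`. -/
def basisInv : Matrix (Fin (s.m + s.r)) (Fin n) ℤ :=
  Matrix.of fun i j => Fin.append (fun k => s.L k j) (fun k => s.Q k j) i

lemma basis_mul_basisInv : s.basis * s.basisInv = 1 := by
  rw [← s.sum_eq_one]
  ext i j
  simp [Matrix.mul_apply, basis, basisInv, Fin.sum_univ_add]

/-- The correction term of the splitting. -/
def corr : ZMod 2 := sgc2 s.basis (s.basisInv * C)

end KernelSplitting

lemma sgc2_eq_core {n p : ℕ} {A : Matrix (Fin n) (Fin n) ℤ} {C : Matrix (Fin p) (Fin p) ℤ}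
    (R : Matrix (Fin n) (Fin p) ℤ) (S : Matrix (Fin p) (Fin n) ℤ)
    (hA : A = R * S) (hC : C = S * R) (s : KernelSplitting A) (t : KernelSplitting C) :
    sgc2 R S = sgc2 (s.Q * R * t.J) (t.Q * S * s.J) + s.corr + t.corr ∧
      (s.Q * R * t.J) * (t.Q * S * s.J) = s.core ∧
      (t.Q * S * s.J) * (s.Q * R * t.J) = t.core := by
  have hRK : s.Q * R * t.K = 0 := by
    rw [Matrix.mul_assoc]
    apply s.Q_mul_eq_zero
    rw [hA, show R * S * (R * t.K) = R * (S * R * t.K) by simp only [Matrix.mul_assoc], ← hC,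
      t.mul_K, Matrix.mul_zero]
  have hSK : t.Q * S * s.K = 0 := by
    rw [Matrix.mul_assoc]
    apply t.Q_mul_eq_zero
    rw [hC, show S * R * (S * s.K) = S * (R * S * s.K) by simp only [Matrix.mul_assoc], ← hA,
      s.mul_K, Matrix.mul_zero]
  have hs : s.J * s.Q = 1 - s.K * s.L := eq_sub_of_add_eq' s.sum_eq_one
  have ht : t.J * t.Q = 1 - t.K * t.L := eq_sub_of_add_eq' t.sum_eq_one
  have hs' : s.K * s.L = 1 - s.J * s.Q := eq_sub_of_add_eq s.sum_eq_one
  have ht' : t.K * t.L = 1 - t.J * t.Q := eq_sub_of_add_eq t.sum_eq_one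
  refine ⟨?_, ?_, ?_⟩
  · have hblock (i j) : (s.basisInv * R * t.basis) (Fin.natAdd s.m i) (Fin.castAdd t.r j) = 0 := by
      have := congr_fun (congr_fun hRK i) j
      simpa [Matrix.mul_apply, KernelSplitting.basis, KernelSplitting.basisInv] using this
    have hblock' (i j) :
        (t.basisInv * S * s.basis) (Fin.natAdd t.m i) (Fin.castAdd s.r j) = 0 := by
      have := congr_fun (congr_fun hSK i) j
      simpa [Matrix.mul_apply, KernelSplitting.basis, KernelSplitting.basisInv] using this
    have e1 : (s.basisInv * R * t.basis).submatrix (Fin.castAdd s.r) (Fin.castAdd t.r) =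
        s.L * R * t.K := by
      ext i j
      simp [Matrix.mul_apply, KernelSplitting.basis, KernelSplitting.basisInv]
    have e2 : (t.basisInv * S * s.basis).submatrix (Fin.castAdd t.r) (Fin.castAdd s.r) =
        t.L * S * s.K := by
      ext i j
      simp [Matrix.mul_apply, KernelSplitting.basis, KernelSplitting.basisInv]
    have e3 : (s.basisInv * R * t.basis).submatrix (Fin.natAdd s.m) (Fin.natAdd t.m) =
        s.Q * R * t.J := by
      ext i j
      simp [Matrix.mul_apply, KernelSplitting.basis, KernelSplitting.basisInv]
    have e4 : (t.basisInv * S * s.basis).submatrix (Fin.natAdd t.m) (Fin.natAdd s.m) =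
        t.Q * S * s.J := by
      ext i j
      simp [Matrix.mul_apply, KernelSplitting.basis, KernelSplitting.basisInv]
    have h0 : sgc2 (s.L * R * t.K) (t.L * S * s.K) = 0 := by
      refine sgc2_eq_zero_of_mul_eq_zero _ _ ?_ ?_
      · calc s.L * R * t.K * (t.L * S * s.K) = s.L * R * (t.K * t.L) * S * s.K := by
              simp only [Matrix.mul_assoc]
          _ = s.L * (R * S * s.K) - s.L * R * t.J * (t.Q * S * s.K) := by
              rw [ht']; simp only [Matrix.mul_sub, Matrix.sub_mul, Matrix.mul_one,
                Matrix.mul_assoc]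
          _ = 0 := by rw [hSK, ← hA, s.mul_K]; simp
      · calc t.L * S * s.K * (s.L * R * t.K) = t.L * S * (s.K * s.L) * R * t.K := by
              simp only [Matrix.mul_assoc]
          _ = t.L * (S * R * t.K) - t.L * S * s.J * (s.Q * R * t.K) := by
              rw [hs']; simp only [Matrix.mul_sub, Matrix.sub_mul, Matrix.mul_one,
                Matrix.mul_assoc]
          _ = 0 := by rw [hRK, ← hC, t.mul_K]; simp
    rw [sgc2_conj R S s.basis_mul_basisInv t.basis_mul_basisInv, sgc2_block _ _ hblock hblock',
      e1, e2, e3, e4, h0, zero_add, ← hA, ← hC]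
    rfl
  · calc s.Q * R * t.J * (t.Q * S * s.J) = s.Q * R * (t.J * t.Q) * S * s.J := by
          simp only [Matrix.mul_assoc]
      _ = s.Q * (R * S) * s.J - s.Q * R * t.K * (t.L * S * s.J) := by
          rw [ht]; simp only [Matrix.mul_sub, Matrix.sub_mul, Matrix.mul_one, Matrix.mul_assoc]
      _ = s.core := by rw [hRK, ← hA]; simp [KernelSplitting.core]
  · calc t.Q * S * s.J * (s.Q * R * t.J) = t.Q * S * (s.J * s.Q) * R * t.J := by
          simp only [Matrix.mul_assoc]
      _ = t.Q * (S * R) * t.J - t.Q * S * s.K * (s.L * R * t.J) := by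
          rw [hs]; simp only [Matrix.mul_sub, Matrix.sub_mul, Matrix.mul_one, Matrix.mul_assoc]
      _ = t.core := by rw [hSK, ← hC]; simp [KernelSplitting.core]

/-- Chains of elementary strong shift equivalences, with sum of `sgc2` and total size. -/
inductive Linked : ∀ {n m : ℕ}, Matrix (Fin n) (Fin n) ℤ → Matrix (Fin m) (Fin m) ℤ →
    ZMod 2 → ℕ → Prop
  | nil {n : ℕ} (A : Matrix (Fin n) (Fin n) ℤ) : Linked A A 0 n
  | cons {n p m : ℕ} {A : Matrix (Fin n) (Fin n) ℤ} {C : Matrix (Fin p) (Fin p) ℤ}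
      {B : Matrix (Fin m) (Fin m) ℤ} {x : ZMod 2} {w : ℕ} (R : Matrix (Fin n) (Fin p) ℤ)
      (S : Matrix (Fin p) (Fin n) ℤ) (hA : A = R * S) (hC : C = S * R) (h : Linked C B x w) :
      Linked A B (sgc2 R S + x) (n + w)

/-- `A` and `B` are conjugate by an invertible matrix whose `sgc2` is `x`. -/
def ConjWith {n m : ℕ} (A : Matrix (Fin n) (Fin n) ℤ) (B : Matrix (Fin m) (Fin m) ℤ)
    (x : ZMod 2) : Prop :=
  ∃ (P : Matrix (Fin n) (Fin m) ℤ) (P' T : Matrix (Fin m) (Fin n) ℤ),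
    P * P' = 1 ∧ P' * P = 1 ∧ A = P * T ∧ B = T * P ∧ x = sgc2 P T

lemma ConjWith.cons {n p m : ℕ} {C : Matrix (Fin p) (Fin p) ℤ}
    {B : Matrix (Fin m) (Fin m) ℤ} {x : ZMod 2} {R : Matrix (Fin n) (Fin p) ℤ}
    {S S' : Matrix (Fin p) (Fin n) ℤ} (hRS : R * S' = 1) (hSR : S' * R = 1)
    (hC : C = S * R) (h : ConjWith C B x) :
    ConjWith (R * S) B (sgc2 R S + x) := by
  obtain ⟨P, P', T, h1, h2, h3, h4, rfl⟩ := h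
  have hS : P * (T * S') = S := by
    rw [← Matrix.mul_assoc, ← h3, hC, Matrix.mul_assoc, hRS, Matrix.mul_one]
  have hT : T * S' * R = T := by rw [Matrix.mul_assoc, hSR, Matrix.mul_one]
  refine ⟨R * P, P' * S', T * S', ?_, ?_, ?_, ?_, ?_⟩
  · rw [show R * P * (P' * S') = R * (P * P') * S' by simp only [Matrix.mul_assoc], h1,
      Matrix.mul_one, hRS]
  · rw [show P' * S' * (R * P) = P' * (S' * R) * P by simp only [Matrix.mul_assoc], hSR,
      Matrix.mul_one, h2]
  · rw [Matrix.mul_assoc, hS]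
  · rw [← Matrix.mul_assoc, hT, h4]
  · rw [← sgc2_cocycle, hS, hT]

lemma Linked.core {n m : ℕ} {A : Matrix (Fin n) (Fin n) ℤ} {B : Matrix (Fin m) (Fin m) ℤ}
    {x : ZMod 2} {w : ℕ} (h : Linked A B x w) :
    ∃ w' ≤ w, Linked (kernelSplitting A).core (kernelSplitting B).core
        (x + (kernelSplitting A).corr + (kernelSplitting B).corr) w' ∧
      (w' = w → (kernelSplitting A).J * (kernelSplitting A).Q = 1 ∧
        (IsUnit A → ConjWith A B x)) := by
  induction h with
  | nil A =>
    refine ⟨_, (kernelSplitting A).r_le, ?_, fun h => ⟨(kernelSplitting A).J_mul_Q_of_r_eq h,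
      fun _ => ⟨1, 1, A, by simp, by simp, by simp, by simp, (sgc2_one_left A).symm⟩⟩⟩
    rw [zero_add, CharTwo.add_self_eq_zero]
    exact .nil _
  | @cons n p m A C B x w R S hA hC h ih =>
    subst hA hC
    obtain ⟨w', hw, hl, hr⟩ := ih
    set s := kernelSplitting (R * S)
    set t := kernelSplitting (S * R)
    obtain ⟨h1, h2, h3⟩ := sgc2_eq_core R S rfl rfl s t
    refine ⟨s.r + w', add_le_add s.r_le hw, ?_, fun h => ?_⟩
    · convert Linked.cons _ _ h2.symm h3.symm hl using 1
      rw [h1]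
      linear_combination CharTwo.add_self_eq_zero s.corr
    · have hs := s.r_le
      have hJQ := s.J_mul_Q_of_r_eq (by omega)
      obtain ⟨ht, hu⟩ := hr (by omega)
      refine ⟨hJQ, fun hA => ?_⟩
      obtain ⟨D, hD⟩ := hA.exists_right_inv
      have hR : R * (S * D) = 1 := by rw [← Matrix.mul_assoc, hD]
      have hS : S * D * R = 1 := by
        refine sub_eq_zero.mp (t.eq_zero_of_mul_eq_zero ht _ ?_)
        rw [Matrix.mul_sub, Matrix.mul_one, Matrix.mul_assoc S R, ← Matrix.mul_assoc R, hR,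
          Matrix.one_mul, sub_self]
      have hD' : D * (R * S) = 1 := mul_eq_one_comm.mp hD
      refine ConjWith.cons hR hS rfl (hu ?_)
      refine IsUnit.of_mul_eq_one (S * D * D * R) ?_
      rw [show S * R * (S * D * D * R) = S * (R * (S * D)) * D * R by
        simp only [Matrix.mul_assoc], hR, Matrix.mul_one, hS]

lemma Linked.conjWith {n m : ℕ} {A : Matrix (Fin n) (Fin n) ℤ} {B : Matrix (Fin m) (Fin m) ℤ}
    {x : ZMod 2} {w : ℕ} (h : Linked A B x w) (hA : IsUnit A) (hB : IsUnit B) :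
    ConjWith A B x := by
  induction w using Nat.strong_induction_on generalizing n m A B x with
  | _ w ih =>
    obtain ⟨w', hw, hl, hr⟩ := h.core
    rcases hw.eq_or_lt with rfl | hlt
    · exact (hr rfl).2 hA
    set s := kernelSplitting A
    set t := kernelSplitting B
    have hs := s.J_mul_Q_of_isUnit hA
    have ht := t.J_mul_Q_of_isUnit hB
    have unit_core {k : ℕ} {C : Matrix (Fin k) (Fin k) ℤ} (u : KernelSplitting C)
        (hC : IsUnit C) : IsUnit u.core := by
      obtain ⟨D, hD⟩ := hC.exists_right_inv
      refine IsUnit.of_mul_eq_one (u.Q * D * u.J) ?_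
      rw [KernelSplitting.core, show u.Q * C * u.J * (u.Q * D * u.J) =
        u.Q * C * (u.J * u.Q) * D * u.J by simp only [Matrix.mul_assoc],
        u.J_mul_Q_of_isUnit hC, Matrix.mul_one, Matrix.mul_assoc u.Q, hD, Matrix.mul_one,
        u.Q_mul_J]
    obtain ⟨P, P', T, h1, h2, h3, h4, h5⟩ := ih w' hlt hl (unit_core s hA) (unit_core t hB)
    have hRS : s.J * P * t.Q * (t.J * T * s.Q) = A := by
      rw [show s.J * P * t.Q * (t.J * T * s.Q) = s.J * P * (t.Q * t.J) * T * s.Q by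
        simp only [Matrix.mul_assoc], t.Q_mul_J, Matrix.mul_one, Matrix.mul_assoc s.J, ← h3,
        KernelSplitting.core, show s.J * (s.Q * A * s.J) * s.Q = s.J * s.Q * A * (s.J * s.Q) by
        simp only [Matrix.mul_assoc], hs, Matrix.mul_one, Matrix.one_mul]
    have hSR : t.J * T * s.Q * (s.J * P * t.Q) = B := by
      rw [show t.J * T * s.Q * (s.J * P * t.Q) = t.J * T * (s.Q * s.J) * P * t.Q by
        simp only [Matrix.mul_assoc], s.Q_mul_J, Matrix.mul_one, Matrix.mul_assoc t.J, ← h4,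
        KernelSplitting.core, show t.J * (t.Q * B * t.J) * t.Q = t.J * t.Q * B * (t.J * t.Q) by
        simp only [Matrix.mul_assoc], ht, Matrix.mul_one, Matrix.one_mul]
    refine ⟨s.J * P * t.Q, t.J * P' * s.Q, t.J * T * s.Q, ?_, ?_, hRS.symm, hSR.symm, ?_⟩
    · rw [show s.J * P * t.Q * (t.J * P' * s.Q) = s.J * (P * (t.Q * t.J) * P') * s.Q by
        simp only [Matrix.mul_assoc], t.Q_mul_J, Matrix.mul_one, h1, Matrix.mul_one, hs]
    · rw [show t.J * P' * s.Q * (s.J * P * t.Q) = t.J * (P' * (s.Q * s.J) * P) * t.Q by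
        simp only [Matrix.mul_assoc], s.Q_mul_J, Matrix.mul_one, h2, Matrix.mul_one, ht]
    · have key := (sgc2_eq_core _ _ hRS.symm hSR.symm s t).1
      have e1 : s.Q * (s.J * P * t.Q) * t.J = P := by
        rw [show s.Q * (s.J * P * t.Q) * t.J = s.Q * s.J * P * (t.Q * t.J) by
          simp only [Matrix.mul_assoc], s.Q_mul_J, t.Q_mul_J, Matrix.one_mul, Matrix.mul_one]
      have e2 : t.Q * (t.J * T * s.Q) * s.J = T := by
        rw [show t.Q * (t.J * T * s.Q) * s.J = t.Q * t.J * T * (s.Q * s.J) by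
          simp only [Matrix.mul_assoc], s.Q_mul_J, t.Q_mul_J, Matrix.one_mul, Matrix.mul_one]
      rw [key, e1, e2, ← h5]
      linear_combination - CharTwo.add_self_eq_zero s.corr - CharTwo.add_self_eq_zero t.corr

lemma SSEChain.exists_linked {k : ℕ} (c : SSEChain ℤ k) :
    ∃ w, Linked (c.mat 0) (c.mat (Fin.last k)) (∑ i, sgc2 (c.R i) (c.S i)) w := by
  induction k with
  | zero => exact ⟨_, .nil _⟩
  | succ k ih =>
    obtain ⟨w, hw⟩ := ih ⟨fun i => c.size i.succ, fun i => c.mat i.succ, fun i => c.R i.succ,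
      fun i => c.S i.succ, fun i => c.hR i.succ, fun i => c.hS i.succ⟩
    rw [Fin.sum_univ_succ]
    exact ⟨_, .cons _ _ (c.hR 0) (c.hS 0) hw⟩

lemma SSEChain.From.exists_conj {k n m : ℕ} {c : SSEChain ℤ k} {A : Matrix (Fin n) (Fin n) ℤ}
    {B : Matrix (Fin m) (Fin m) ℤ} (hc : c.From A B) (hA : IsUnit A) (hB : IsUnit B) :
    ConjWith A B (∑ i, sgc2 (c.R i) (c.S i)) := by
  obtain ⟨w, hw⟩ := c.exists_linked
  obtain ⟨h0, h1, rfl, rfl⟩ := hc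
  generalize c.mat 0 = M at *
  generalize c.mat (Fin.last k) = N at *
  generalize c.size 0 = a at *
  generalize c.size (Fin.last k) = b at *
  subst h0 h1
  exact hw.conjWith hA hB

end Reduction

section UnitRelations

open NumberField

lemma NumberField.Units.exists_relation {K : Type*} [Field K] [NumberField K]
    (hodd : Odd (Module.finrank ℚ K)) {m : ℕ} (hm : NumberField.Units.rank K < m)
    (x : Fin m → (𝓞 K)ˣ) :
    ∃ e : Fin m → ℤ, (∃ i, ¬ Even (e i)) ∧ (∏ i, x i ^ e i = 1 ∨ ∏ i, x i ^ e i = -1) := by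
  let y : Fin m → Additive (𝓞 K)ˣ := fun i => Additive.ofMul (x i)
  have hy : ¬ LinearIndependent ℤ y := fun h => by
    have := h.fintype_card_le_finrank
    rw [NumberField.Units.finrank_eq, Fintype.card_fin] at this
    omega
  obtain ⟨g, hg, i, hi⟩ := Fintype.not_linearIndependent_iff.mp hy
  obtain ⟨e, he, hgcd⟩ := Finset.extract_gcd g ⟨i, Finset.mem_univ i⟩
  obtain ⟨d, hd⟩ : ∃ d : ℤ, d = Finset.univ.gcd g := ⟨_, rfl⟩
  rw [← hd] at he
  have hd0 : d ≠ 0 := fun h => hi (by rw [he i (Finset.mem_univ i), h, zero_mul])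
  have hpow : (∏ i, x i ^ e i) ^ d = 1 := by
    have h1 : ∏ i, x i ^ g i = 1 := by simpa [y] using! congr_arg Additive.toMul hg
    rw [← Finset.prod_zpow, ← h1]
    exact Finset.prod_congr rfl fun i hi => by rw [he i hi, mul_comm, zpow_mul]
  refine ⟨e, ?_, ?_⟩
  · by_contra! h
    have : (2 : ℤ) ∣ Finset.univ.gcd e := Finset.dvd_gcd fun i _ => (h i).two_dvd
    rw [hgcd] at this
    omega
  · have hmem : ∏ i, x i ^ e i ∈ NumberField.Units.torsion K :=
      isOfFinOrder_iff_zpow_eq_one.mpr ⟨d, hd0, hpow⟩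
    exact NumberField.Units.torsion_eq_one_or_neg_one_of_odd_finrank hodd ⟨_, hmem⟩

lemma NumberField.InfinitePlace.rank_le_four {K : Type*} [Field K] [NumberField K]
    (h7 : Module.finrank ℚ K = 7)
    (c : { φ : K →+* ℂ // ComplexEmbedding.IsReal φ } → Fin 3) (hc : Function.Injective c) :
    NumberField.Units.rank K < 5 := by
  classical
  have h1 := Fintype.card_le_of_injective c hc
  rw [NumberField.InfinitePlace.card_real_embeddings, Fintype.card_fin] at h1
  have h2 := NumberField.InfinitePlace.card_add_two_mul_card_eq_rank K
  have h3 := NumberField.InfinitePlace.card_eq_nrRealPlaces_add_nrComplexPlaces K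
  rw [NumberField.Units.rank, h3]
  omega

end UnitRelations

section RealRoots

lemma unique_neg_root {a b : ℝ} (ha : 0 < a) (hb : 0 < b)
    (hfa : a ^ 7 + 23 * a ^ 4 - 28 * a ^ 3 + 33 * a ^ 2 - 17 * a - 1 = 0)
    (hfb : b ^ 7 + 23 * b ^ 4 - 28 * b ^ 3 + 33 * b ^ 2 - 17 * b - 1 = 0) : a = b := by
  have key : (b - a) * (a * b * ((b ^ 5 + b ^ 4 * a + b ^ 3 * a ^ 2 + b ^ 2 * a ^ 3 + b * a ^ 4
      + a ^ 5) + (23 * (b ^ 2 + b * a + a ^ 2) - 28 * (b + a) + 33)) + 1) = 0 := by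
    linear_combination a * hfb - b * hfa
  have h1 : 0 < 23 * (b ^ 2 + b * a + a ^ 2) - 28 * (b + a) + 33 := by
    nlinarith [sq_nonneg (a - b), sq_nonneg (a + b - 1)]
  have h2 : 0 < a * b * ((b ^ 5 + b ^ 4 * a + b ^ 3 * a ^ 2 + b ^ 2 * a ^ 3 + b * a ^ 4
      + a ^ 5) + (23 * (b ^ 2 + b * a + a ^ 2) - 28 * (b + a) + 33)) + 1 := by positivity
  linarith [(mul_eq_zero.mp key).resolve_right h2.ne']

lemma unique_small_root {a b : ℝ} (ha : 0 < a) (hb : 0 < b) (ha1 : a ≤ 1) (hb1 : b ≤ 1)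
    (hfa : a ^ 7 - 23 * a ^ 4 - 28 * a ^ 3 - 33 * a ^ 2 - 17 * a + 1 = 0)
    (hfb : b ^ 7 - 23 * b ^ 4 - 28 * b ^ 3 - 33 * b ^ 2 - 17 * b + 1 = 0) : a = b := by
  have key : (b - a) * (17 - (b ^ 6 + b ^ 5 * a + b ^ 4 * a ^ 2 + b ^ 3 * a ^ 3 + b ^ 2 * a ^ 4
      + b * a ^ 5 + a ^ 6) + (23 * (b ^ 3 + b ^ 2 * a + b * a ^ 2 + a ^ 3)
      + 28 * (b ^ 2 + b * a + a ^ 2) + 33 * (b + a))) = 0 := by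
    linear_combination hfa - hfb
  have hmon (i j : ℕ) : b ^ i * a ^ j ≤ 1 :=
    mul_le_one₀ (pow_le_one₀ hb.le hb1) (by positivity) (pow_le_one₀ ha.le ha1)
  have h2 : 0 < 23 * (b ^ 3 + b ^ 2 * a + b * a ^ 2 + a ^ 3)
      + 28 * (b ^ 2 + b * a + a ^ 2) + 33 * (b + a) := by positivity
  have h3 := hmon 6 0
  have h4 := hmon 5 1
  have h5 := hmon 4 2
  have h6 := hmon 3 3
  have h7 := hmon 2 4
  have h8 := hmon 1 5
  have h9 := hmon 0 6
  simp only [pow_zero, pow_one, mul_one, one_mul] at h3 h4 h8 h9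
  rcases mul_eq_zero.mp key with h | h <;> linarith

lemma unique_large_root {a b : ℝ} (ha : 1 ≤ a) (hb : 1 ≤ b)
    (hfa : a ^ 7 - 23 * a ^ 4 - 28 * a ^ 3 - 33 * a ^ 2 - 17 * a + 1 = 0)
    (hfb : b ^ 7 - 23 * b ^ 4 - 28 * b ^ 3 - 33 * b ^ 2 - 17 * b + 1 = 0) : a = b := by
  have ha0 : 0 < a := by linarith
  have hb0 : 0 < b := by linarith
  have key : (b - a) * (28 * (a ^ 3 * b ^ 3) - (b ^ 3 + b ^ 2 * a + b * a ^ 2 + a ^ 3)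
      + (a ^ 4 * b ^ 4 * (b ^ 2 + b * a + a ^ 2)
      + 33 * (a ^ 2 * b ^ 2 * (b + a)) + 17 * (a * b * (b ^ 2 + b * a + a ^ 2)))) = 0 := by
    linear_combination a ^ 4 * hfb - b ^ 4 * hfa
  have h2 : 0 < a ^ 4 * b ^ 4 * (b ^ 2 + b * a + a ^ 2)
      + 33 * (a ^ 2 * b ^ 2 * (b + a)) + 17 * (a * b * (b ^ 2 + b * a + a ^ 2)) := by positivity
  have hmon (i j : ℕ) (hi : i ≤ 3) (hj : j ≤ 3) : b ^ i * a ^ j ≤ a ^ 3 * b ^ 3 := by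
    rw [mul_comm]
    exact mul_le_mul (pow_le_pow_right₀ ha hj) (pow_le_pow_right₀ hb hi) (by positivity)
      (by positivity)
  have h3 := hmon 3 0 (by norm_num) (by norm_num)
  have h4 := hmon 2 1 (by norm_num) (by norm_num)
  have h5 := hmon 1 2 (by norm_num) (by norm_num)
  have h6 := hmon 0 3 (by norm_num) (by norm_num)
  have h7 : 0 < a ^ 3 * b ^ 3 := by positivity
  simp only [pow_zero, pow_one, mul_one, one_mul] at h3 h4 h5 h6
  rcases mul_eq_zero.mp key with h | h <;> linarith

/-- The sign and size class of a real root. -/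
noncomputable def rootClass (x : ℝ) : Fin 3 := if x < 0 then 0 else if x ≤ 1 then 1 else 2

lemma rootClass_injOn {a b : ℝ}
    (hfa : a ^ 7 - 23 * a ^ 4 - 28 * a ^ 3 - 33 * a ^ 2 - 17 * a + 1 = 0)
    (hfb : b ^ 7 - 23 * b ^ 4 - 28 * b ^ 3 - 33 * b ^ 2 - 17 * b + 1 = 0)
    (h : rootClass a = rootClass b) : a = b := by
  have ha0 : a ≠ 0 := by rintro rfl; norm_num at hfa
  have hb0 : b ≠ 0 := by rintro rfl; norm_num at hfb
  unfold rootClass at h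
  by_cases h1 : a < 0 <;> by_cases h2 : b < 0 <;> by_cases h3 : a ≤ 1 <;> by_cases h4 : b ≤ 1 <;>
    simp only [h1, h2, h3, h4, if_true, if_false, Fin.reduceEq] at h
  all_goals first
    | exact neg_injective (unique_neg_root (neg_pos.mpr h1) (neg_pos.mpr h2)
        (by linear_combination -hfa) (by linear_combination -hfb))
    | exact unique_small_root (lt_of_le_of_ne (not_lt.mp h1) ha0.symm)
        (lt_of_le_of_ne (not_lt.mp h2) hb0.symm) h3 h4 hfa hfb
    | exact unique_large_root (not_le.mp h3).le (not_le.mp h4).le hfa hfb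

end RealRoots

section CharPoly

open Polynomial

/-- The characteristic polynomial of `Amat`. -/
noncomputable def charPolyA : ℤ[X] :=
  X ^ 7 - 23 * X ^ 4 - 28 * X ^ 3 - 33 * X ^ 2 - 17 * X + 1

lemma charPolyA_natDegree : charPolyA.natDegree = 7 := by
  unfold charPolyA; compute_degree!

lemma charPolyA_monic : charPolyA.Monic := by
  unfold charPolyA; monicity!

instance fact_prime_five : Fact (Nat.Prime 5) := ⟨by norm_num⟩

lemma irreducible_charPolyA_mod_five : Irreducible (charPolyA.map (Int.castRingHom (ZMod 5))) := by
  have hm : (charPolyA.map (Int.castRingHom (ZMod 5))).Monic := charPolyA_monic.map _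
  have hd : (charPolyA.map (Int.castRingHom (ZMod 5))).natDegree = 7 := by
    rw [charPolyA_monic.natDegree_map, charPolyA_natDegree]
  have hcoeff : charPolyA.map (Int.castRingHom (ZMod 5)) =
      X ^ 7 - C 23 * X ^ 4 - C 28 * X ^ 3 - C 33 * X ^ 2 - C 17 * X + C 1 := by
    simp [charPolyA, C_ofNat]
  rw [hm.irreducible_iff_natDegree']
  refine ⟨fun h => by simp [h] at hd, fun g q hg hq hgq hmem => ?_⟩
  rw [hd, Finset.mem_Ioc] at hmem
  have hdeg : g.natDegree + q.natDegree = 7 := by rw [← hg.natDegree_mul hq, hgq, hd]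
  have hc (i : ℕ) := congr_arg (coeff · i) (hgq.trans hcoeff)
  have hq1 : q.coeff q.natDegree = 1 := hq
  have hg1 : g.coeff g.natDegree = 1 := hg
  have hq0 (i : ℕ) (hi : q.natDegree < i) : q.coeff i = 0 := coeff_eq_zero_of_natDegree_lt hi
  have hg0 (i : ℕ) (hi : g.natDegree < i) : g.coeff i = 0 := coeff_eq_zero_of_natDegree_lt hi
  have c0 := hc 0
  have c1 := hc 1
  have c2 := hc 2
  have c3 := hc 3
  have c4 := hc 4
  have c5 := hc 5
  have c6 := hc 6
  clear hc hcoeff hgq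
  simp [Polynomial.coeff_mul, Finset.Nat.antidiagonal_succ, coeff_X, coeff_one,
    coeff_X_pow, coeff_C] at c0 c1 c2 c3 c4 c5 c6
  obtain ⟨hl, hu⟩ := hmem
  have h7 : g.natDegree = 7 - q.natDegree := by omega
  rw [h7] at hg1 hg0
  clear h7
  generalize q.natDegree = n at *
  interval_cases n <;> norm_num at hg1 hg0 <;>
    simp [hq0, hg0, hq1, hg1] at c0 c1 c2 c3 c4 c5 c6
  · have e5 : g.coeff 5 = -(q.coeff 0) := by linear_combination c6
    have e4 : g.coeff 4 = -(g.coeff 5 * q.coeff 0) := by linear_combination c5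
    have e3 : g.coeff 3 = -23 - (g.coeff 4 * q.coeff 0) := by linear_combination c4
    have e2 : g.coeff 2 = -28 - (g.coeff 3 * q.coeff 0) := by linear_combination c3
    have e1 : g.coeff 1 = -33 - (g.coeff 2 * q.coeff 0) := by linear_combination c2
    have e0 : g.coeff 0 = -17 - (g.coeff 1 * q.coeff 0) := by linear_combination c1
    rw [e0, e1, e2, e3, e4, e5] at c0
    clear c1 c2 c3 c4 c5 c6 e0 e1 e2 e3 e4 e5
    generalize q.coeff 0 = x at c0
    clear hg1 hg0 hq0 hq1
    revert x
    decide +kernel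
  · have e4 : g.coeff 4 = -(q.coeff 1) := by linear_combination c6
    have e3 : g.coeff 3 = -(g.coeff 4 * q.coeff 1 + q.coeff 0) := by linear_combination c5
    have e2 : g.coeff 2 = -23 - (g.coeff 3 * q.coeff 1 + g.coeff 4 * q.coeff 0) := by
      linear_combination c4
    have e1 : g.coeff 1 = -28 - (g.coeff 2 * q.coeff 1 + g.coeff 3 * q.coeff 0) := by
      linear_combination c3
    have e0 : g.coeff 0 = -33 - (g.coeff 1 * q.coeff 1 + g.coeff 2 * q.coeff 0) := by
      linear_combination c2
    rw [e0, e1, e2, e3, e4] at c0 c1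
    clear c2 c3 c4 c5 c6 e0 e1 e2 e3 e4
    generalize q.coeff 0 = x at c0 c1
    generalize q.coeff 1 = y at c0 c1
    clear hg1 hg0 hq0 hq1
    revert x y
    decide +kernel
  · have e3 : g.coeff 3 = -(q.coeff 2) := by linear_combination c6
    have e2 : g.coeff 2 = -(g.coeff 3 * q.coeff 2 + q.coeff 1) := by linear_combination c5
    have e1 : g.coeff 1 = -23 - (g.coeff 2 * q.coeff 2 + g.coeff 3 * q.coeff 1 + q.coeff 0) := by
      linear_combination c4
    have e0 : g.coeff 0 =
        -28 - (g.coeff 1 * q.coeff 2 + g.coeff 2 * q.coeff 1 + g.coeff 3 * q.coeff 0) := by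
      linear_combination c3
    rw [e0, e1, e2, e3] at c0 c1 c2
    clear c3 c4 c5 c6 e0 e1 e2 e3
    generalize q.coeff 0 = x at c0 c1 c2
    generalize q.coeff 1 = y at c0 c1 c2
    generalize q.coeff 2 = z at c0 c1 c2
    clear hg1 hg0 hq0 hq1
    revert x y z
    decide +kernel

end CharPoly

section NumberFieldOfA

open Polynomial NumberField

lemma charPolyA_irreducible : Irreducible charPolyA :=
  charPolyA_monic.irreducible_of_irreducible_map (Int.castRingHom (ZMod 5)) _
    irreducible_charPolyA_mod_five

instance fact_irreducible_charPolyA : Fact (Irreducible (charPolyA.map (algebraMap ℤ ℚ))) :=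
  ⟨(charPolyA_monic.irreducible_iff_irreducible_map_fraction_map (K := ℚ)).mp
    charPolyA_irreducible⟩

/-- The number field generated by an eigenvalue of `Amat`. -/
abbrev FieldA : Type := AdjoinRoot (charPolyA.map (algebraMap ℤ ℚ))

/-- The order `ℤ[α]` generated by an eigenvalue `α` of `Amat`. -/
abbrev OrderA : Type := AdjoinRoot charPolyA

instance numberField_fieldA : NumberField FieldA where
  to_charZero := charZero_of_injective_algebraMap (algebraMap ℚ FieldA).injective
  to_finiteDimensional :=
    (AdjoinRoot.powerBasis (Fact.out : Irreducible (charPolyA.map (algebraMap ℤ ℚ))).ne_zero).finite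

lemma finrank_fieldA : Module.finrank ℚ FieldA = 7 := by
  rw [(AdjoinRoot.powerBasis
    (Fact.out : Irreducible (charPolyA.map (algebraMap ℤ ℚ))).ne_zero).finrank,
    AdjoinRoot.powerBasis_dim, charPolyA_monic.natDegree_map, charPolyA_natDegree]

lemma eval₂_charPolyA {S : Type*} [CommRing S] (f : ℤ →+* S) (x : S) :
    charPolyA.eval₂ f x = x ^ 7 - 23 * x ^ 4 - 28 * x ^ 3 - 33 * x ^ 2 - 17 * x + 1 := by
  simp [charPolyA, eval₂_sub, eval₂_mul]

lemma eval₂_root_fieldA (f : ℤ →+* FieldA) :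
    charPolyA.eval₂ f (AdjoinRoot.root (charPolyA.map (algebraMap ℤ ℚ))) = 0 := by
  have := AdjoinRoot.eval₂_root (charPolyA.map (algebraMap ℤ ℚ))
  rwa [eval₂_map, RingHom.ext_int (RingHom.comp _ _) f] at this

lemma rank_fieldA_lt : NumberField.Units.rank FieldA < 5 := by
  refine NumberField.InfinitePlace.rank_le_four finrank_fieldA
    (fun φ => rootClass (φ.2.embedding (AdjoinRoot.root _))) fun φ ψ h => ?_
  have hroot (χ : FieldA →+* ℝ) :
      (χ (AdjoinRoot.root _)) ^ 7 - 23 * (χ (AdjoinRoot.root _)) ^ 4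
        - 28 * (χ (AdjoinRoot.root _)) ^ 3 - 33 * (χ (AdjoinRoot.root _)) ^ 2
        - 17 * (χ (AdjoinRoot.root _)) + 1 = 0 := by
    have := congr_arg χ (eval₂_root_fieldA (Int.castRingHom _))
    rwa [hom_eval₂, eval₂_charPolyA, map_zero] at this
  have heq := rootClass_injOn (hroot φ.2.embedding) (hroot ψ.2.embedding) h
  have : (φ : FieldA →+* ℂ) (AdjoinRoot.root _) = (ψ : FieldA →+* ℂ) (AdjoinRoot.root _) := by
    rw [← φ.2.coe_embedding_apply, ← ψ.2.coe_embedding_apply, heq]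
  refine Subtype.ext (RingHom.ext fun x => ?_)
  induction x using AdjoinRoot.induction_on with
  | ih p =>
    rw [← AdjoinRoot.aeval_eq, aeval_def, hom_eval₂, hom_eval₂, this,
      RingHom.ext_rat (RingHom.comp _ _) (RingHom.comp (ψ : FieldA →+* ℂ) _)]

lemma isIntegral_root_fieldA :
    IsIntegral ℤ (AdjoinRoot.root (charPolyA.map (algebraMap ℤ ℚ)) : FieldA) :=
  ⟨charPolyA, charPolyA_monic, eval₂_root_fieldA _⟩

/-- An eigenvalue of `Amat`, as an algebraic integer. -/
noncomputable def integerA : 𝓞 FieldA := IsIntegralClosure.mk' (𝓞 FieldA) _ isIntegral_root_fieldA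

lemma algebraMap_integerA : algebraMap (𝓞 FieldA) FieldA integerA = AdjoinRoot.root _ :=
  IsIntegralClosure.algebraMap_mk' _ _ _

/-- The embedding of `ℤ[α]` into the ring of integers. -/
noncomputable def orderAToIntegers : OrderA →+* 𝓞 FieldA :=
  AdjoinRoot.lift (Int.castRingHom _) integerA <| by
    apply FaithfulSMul.algebraMap_injective (𝓞 FieldA) FieldA
    rw [hom_eval₂, algebraMap_integerA, eval₂_root_fieldA, map_zero]

lemma orderAToIntegers_injective : Function.Injective orderAToIntegers := by
  rw [injective_iff_map_eq_zero]
  intro x hx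
  induction x using AdjoinRoot.induction_on with
  | ih p =>
    rw [orderAToIntegers, AdjoinRoot.lift_mk] at hx
    have h := congr_arg (algebraMap (𝓞 FieldA) FieldA) hx
    rw [hom_eval₂, map_zero, algebraMap_integerA] at h
    rw [AdjoinRoot.mk_eq_zero]
    refine (Polynomial.map_dvd_map (algebraMap ℤ ℚ) (algebraMap ℤ ℚ).injective_int
      charPolyA_monic).mp ?_
    rw [← AdjoinRoot.mk_eq_zero, ← AdjoinRoot.aeval_eq, aeval_def, eval₂_map, ← h,
      RingHom.ext_int (RingHom.comp _ _) ((algebraMap (𝓞 FieldA) FieldA).comp (Int.castRingHom _))]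

lemma exists_relation_orderA {m : ℕ} (hm : 5 ≤ m) (x : Fin m → OrderAˣ) :
    ∃ e : Fin m → ℤ, (∃ i, ¬ Even (e i)) ∧ (∏ i, x i ^ e i = 1 ∨ ∏ i, x i ^ e i = -1) := by
  have hinj : Function.Injective (Units.map orderAToIntegers.toMonoidHom) :=
    Units.map_injective orderAToIntegers_injective
  obtain ⟨e, he, h⟩ := NumberField.Units.exists_relation (K := FieldA)
    (by rw [finrank_fieldA]; decide) (rank_fieldA_lt.trans_le hm)
    (fun i => Units.map orderAToIntegers.toMonoidHom (x i))
  simp_rw [← map_zpow, ← map_prod] at h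
  refine ⟨e, he, h.imp (fun h => hinj (h.trans (map_one _).symm)) fun h => hinj (h.trans ?_)⟩
  ext
  simp

end NumberFieldOfA

section MatricesCommutingWithA

open Polynomial Matrix

/-- A vector whose iterates under `Amat` form a basis of `ℤ⁷`. -/
def cyclicVec : Fin 7 → ℤ := ![-1, 0, 0, 1, 0, -1, 0]

/-- The matrix with columns `Amat ^ j *ᵥ cyclicVec`. -/
def cyclicMat : Matrix (Fin 7) (Fin 7) ℤ := of fun i j => (Amat ^ (j : ℕ) *ᵥ cyclicVec) i

/-- The inverse of `cyclicMat`. -/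
def cyclicInv : Matrix (Fin 7) (Fin 7) ℤ :=
  !![-127001, -133386, -133725, -6742, 339, 120258, 6385;
     -232980, -244694, -245316, -12369, 622, 220611, 11713;
     -197038, -206944, -207471, -10461, 526, 186577, 9906;
     -155088, -162885, -163299, -8234, 414, 146854, 7797;
     19, 20, 20, 1, 0, -18, -1;
     358, 376, 377, 19, -1, -339, -18;
     6743, 7082, 7100, 358, -18, -6385, -339]

lemma cyclicInv_mul_cyclicMat : cyclicInv * cyclicMat = 1 := by decide +kernel

lemma cyclicMat_mul_cyclicInv : cyclicMat * cyclicInv = 1 :=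
  mul_eq_one_comm.mp cyclicInv_mul_cyclicMat

lemma eq_of_mulVec_cyclicVec {U V : Matrix (Fin 7) (Fin 7) ℤ} (hU : Commute U Amat)
    (hV : Commute V Amat) (h : U *ᵥ cyclicVec = V *ᵥ cyclicVec) : U = V := by
  have key (W : Matrix (Fin 7) (Fin 7) ℤ) (hW : Commute W Amat) (i j : Fin 7) :
      (W * cyclicMat) i j = (Amat ^ (j : ℕ) *ᵥ (W *ᵥ cyclicVec)) i := by
    rw [mulVec_mulVec, ← (hW.pow_right j).eq, ← mulVec_mulVec]
    rfl
  have : U * cyclicMat = V * cyclicMat := by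
    ext i j
    rw [key U hU, key V hV, h]
  calc U = U * cyclicMat * cyclicInv := by rw [mul_assoc, cyclicMat_mul_cyclicInv, mul_one]
    _ = V := by rw [this, mul_assoc, cyclicMat_mul_cyclicInv, mul_one]

lemma aeval_Amat_charPolyA : aeval Amat charPolyA = 0 := by
  have h : Amat ^ 7 = 23 * Amat ^ 4 + 28 * Amat ^ 3 + 33 * Amat ^ 2 + 17 * Amat - 1 := by
    decide +kernel
  simp only [charPolyA, map_add, map_sub, map_mul, map_pow, aeval_X, map_ofNat, map_one, h]
  abel

/-- The ring homomorphism `ℤ[α] → ℤ[A]` sending `α` to `Amat`. -/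
noncomputable def orderMat : OrderA →+* Matrix (Fin 7) (Fin 7) ℤ :=
  Ideal.Quotient.lift (Ideal.span {charPolyA}) (aeval Amat).toRingHom fun p hp => by
    obtain ⟨q, rfl⟩ := Ideal.mem_span_singleton.mp hp
    simp [aeval_Amat_charPolyA]

lemma orderMat_mk (p : ℤ[X]) : orderMat (AdjoinRoot.mk charPolyA p) = aeval Amat p := rfl

lemma orderMat_root : orderMat (AdjoinRoot.root charPolyA) = Amat :=
  (orderMat_mk X).trans (aeval_X _)

lemma commute_orderMat (x : OrderA) : Commute (orderMat x) Amat := by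
  rw [← orderMat_root]
  exact (Commute.all x _).map orderMat

/-- The element of `ℤ[α]` with given coordinates in the power basis. -/
noncomputable def orderElt (c : Fin 7 → ℤ) : OrderA :=
  ∑ i, (c i : OrderA) * AdjoinRoot.root charPolyA ^ (i : ℕ)

lemma orderElt_surjective : Function.Surjective orderElt := by
  intro x
  induction x using AdjoinRoot.induction_on with
  | ih p =>
    refine ⟨fun i => (p %ₘ charPolyA).coeff i, ?_⟩
    have hp : AdjoinRoot.mk charPolyA p = AdjoinRoot.mk charPolyA (p %ₘ charPolyA) := by
      rw [AdjoinRoot.mk_eq_mk]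
      exact ⟨p /ₘ charPolyA, by rw [modByMonic_eq_sub_mul_div]; ring⟩
    have hd : (p %ₘ charPolyA).natDegree < 7 := by
      rw [← charPolyA_natDegree]
      exact natDegree_modByMonic_lt _ charPolyA_monic fun h => by
        simpa [h] using charPolyA_natDegree
    rw [hp, orderElt]
    conv_rhs => rw [(p %ₘ charPolyA).as_sum_range' 7 hd]
    rw [map_sum, Finset.sum_range]
    refine Finset.sum_congr rfl fun i _ => ?_
    rw [← C_mul_X_pow_eq_monomial, map_mul, map_pow, AdjoinRoot.mk_X]
    simp

lemma orderMat_orderElt_mulVec (c : Fin 7 → ℤ) :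
    orderMat (orderElt c) *ᵥ cyclicVec = cyclicMat *ᵥ c := by
  ext i
  simp only [orderElt, map_sum, map_mul, map_intCast, map_pow, orderMat_root, sum_mulVec,
    Finset.sum_apply]
  rw [mulVec, dotProduct]
  refine Finset.sum_congr rfl fun j _ => ?_
  rw [← zsmul_eq_mul, smul_mulVec, Pi.smul_apply, smul_eq_mul, mul_comm]
  rfl

lemma orderMat_injective : Function.Injective orderMat := by
  rw [injective_iff_map_eq_zero]
  intro x hx
  obtain ⟨c, rfl⟩ := orderElt_surjective x
  have h : cyclicMat *ᵥ c = 0 := by rw [← orderMat_orderElt_mulVec, hx, zero_mulVec]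
  have hc : c = 0 := by
    rw [← one_mulVec c, ← cyclicInv_mul_cyclicMat, ← mulVec_mulVec, h, mulVec_zero]
  simp [hc, orderElt]

/-- The element of `ℤ[α]` represented by a matrix commuting with `Amat`. -/
noncomputable def commutantElt (U : Matrix (Fin 7) (Fin 7) ℤ) : OrderA :=
  orderElt (cyclicInv *ᵥ (U *ᵥ cyclicVec))

lemma orderMat_commutantElt {U : Matrix (Fin 7) (Fin 7) ℤ} (hU : Commute U Amat) :
    orderMat (commutantElt U) = U := by
  refine eq_of_mulVec_cyclicVec (commute_orderMat _) hU ?_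
  rw [commutantElt, orderMat_orderElt_mulVec, mulVec_mulVec, cyclicMat_mul_cyclicInv, one_mulVec]

/-- The unit of `ℤ[α]` represented by an invertible matrix commuting with `Amat`. -/
noncomputable def commutantUnit (U : (Matrix (Fin 7) (Fin 7) ℤ)ˣ) (hU : Commute U.val Amat) :
    OrderAˣ where
  val := commutantElt U.val
  inv := commutantElt U⁻¹.val
  val_inv := orderMat_injective <| by
    rw [map_mul, orderMat_commutantElt hU, orderMat_commutantElt hU.units_inv_left, map_one,
      Units.mul_inv]
  inv_val := orderMat_injective <| by
    rw [map_mul, orderMat_commutantElt hU, orderMat_commutantElt hU.units_inv_left, map_one,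
      Units.inv_mul]

lemma orderMat_commutantUnit (U : (Matrix (Fin 7) (Fin 7) ℤ)ˣ) (hU : Commute U.val Amat) :
    orderMat (commutantUnit U hU) = U :=
  orderMat_commutantElt hU

lemma orderMat_commutantUnit_inv (U : (Matrix (Fin 7) (Fin 7) ℤ)ˣ) (hU : Commute U.val Amat) :
    orderMat (commutantUnit U hU)⁻¹.val = U⁻¹.val :=
  orderMat_commutantElt hU.units_inv_left

end MatricesCommutingWithA

section UnitClasses

open scoped Matrix

/-- The class `sgc2 U (U⁻¹ A)` of a unit `U` of `ℤ[A]`, as a homomorphism. -/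
noncomputable def unitClass : OrderAˣ →* Multiplicative (ZMod 2) :=
  MonoidHom.mk' (fun u => Multiplicative.ofAdd
    (sgc2 (orderMat u) (orderMat (u⁻¹.val * AdjoinRoot.root charPolyA)))) fun u v => by
      have h := sgc2_cocycle (orderMat u) (orderMat v)
        (orderMat ((u * v)⁻¹.val * AdjoinRoot.root charPolyA))
      rw [← map_mul, ← map_mul, ← map_mul] at h
      have h1 : v.val * ((u * v)⁻¹.val * AdjoinRoot.root charPolyA)
          = u⁻¹.val * AdjoinRoot.root charPolyA := by
        rw [mul_inv_rev, Units.val_mul, mul_assoc, Units.mul_inv_cancel_left]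
      have h2 : (u * v)⁻¹.val * AdjoinRoot.root charPolyA * u.val
          = v⁻¹.val * AdjoinRoot.root charPolyA := by
        rw [mul_inv_rev, Units.val_mul, mul_right_comm, mul_assoc v⁻¹.val, Units.inv_mul, mul_one]
      rw [h1, h2] at h
      exact congr_arg Multiplicative.ofAdd h.symm

lemma unitClass_commutantUnit (U : (Matrix (Fin 7) (Fin 7) ℤ)ˣ) (hU : Commute U.val Amat) :
    unitClass (commutantUnit U hU) = Multiplicative.ofAdd (sgc2 U.val (U⁻¹.val * Amat)) := by
  rw [← orderMat_root, ← orderMat_commutantUnit_inv U hU, ← map_mul]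
  conv_rhs => rw [← orderMat_commutantUnit U hU]
  rfl

lemma unitClass_neg_one : unitClass (-1) = 1 := by
  have h : sgc2 (-1) (-Amat) = 0 := by decide +kernel
  have h1 : unitClass (-1) = Multiplicative.ofAdd
      (sgc2 (orderMat (-1)) (orderMat (-1 * AdjoinRoot.root charPolyA))) := rfl
  rw [h1, map_mul, map_neg, map_one, orderMat_root, neg_one_mul, h, ofAdd_zero]

lemma even_exponent {ι G M : Type*} [Fintype ι] [CommGroup G] [CommGroup M] (χ : G →* M)
    (x : ι → G) (e : ι → ℤ) (j : ι) (h : χ (∏ i, x i ^ e i) = 1)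
    (hj : χ (x j) ^ 2 = 1) (hj1 : χ (x j) ≠ 1)
    (hi : ∀ i ≠ j, χ (x i ^ e i) = 1) : Even (e j) := by
  rw [map_prod, Fintype.prod_eq_single j hi, map_zpow] at h
  by_contra! ho
  obtain ⟨k, hk⟩ := Int.not_even_iff_odd.mp ho
  rw [hk, zpow_add, zpow_mul, zpow_ofNat, hj, one_zpow, one_mul, zpow_one] at h
  exact hj1 h

/-- Matrices of four multiplicatively independent units of `ℤ[α]`. -/
def unitMat : Fin 4 → Matrix (Fin 7) (Fin 7) ℤ :=
  ![
    !![0, 0, 1, 1, 3, 0, 0;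
       1, 0, 0, 0, 3, 0, 0;
       0, 1, 0, 0, 3, 0, 0;
       0, 0, 1, 0, 3, 0, 0;
       0, 0, 0, 0, 0, 0, 1;
       1, 1, 1, 1, 10, 0, 0;
       1, 1, 1, 1, 0, 1, 0],
    !![82220952, 87596027, 105193364, 80582249, 455575095, 42492588, 139135557;
       68470745, 72942921, 87596027, 67103703, 379372044, 35384895, 115862166;
       64270230, 68470745, 82220952, 62984912, 356098653, 33214557, 108754473;
       62984912, 67103703, 80582249, 61728628, 348990960, 32551422, 106584135;
       47323010, 50415687, 60542715, 46378519, 262204681, 24456526, 80078829;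
       229414741, 244406998, 293500325, 224835060, 1271124621, 118561219, 388208722;
       154951042, 165078070, 198236884, 151858365, 858545053, 80078829, 262204681],
    !![845316904900, -665453826458, 442227153811, -1215229626619, 92028387888, 171194395107, -125517903906;
       -1272014537566, 1001360479900, -665453826458, 1828651175537, -138482321373, -257609611380, 188876618421;
       1615822689590, -1272014537566, 845316904900, -2322910606888, 175912200954, 327237970107, -239927388066;
       -2322910606888, 1828651175537, -1215229626619, 3339421906895, -252891805533, -470438097327, 344920193421;
       29103527347, -22910997653, 15225497067, -41839301302, 3168457517, 5894074438, -4321472489;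
       1149430634008, -904859478391, 601324112986, -1652424259601, 125136794980, 232783801010, -170674599113;
       -21338395704, 16798099016, -11163172006, 30676129296, -2323079243, -4321472489, 3168457517],
    !![-994690, 3037347, -897976, -2455063, -543609, 409548, 115761;
       -2363353, -1630267, 3037347, 1966635, 209562, -359613, 383664;
       2693922, -2363353, -994690, 1480260, 477465, -226029, -385497;
       1480260, 1966635, -2455063, -2065402, -291696, 367674, -251913;
       -203842, 8017, 175103, 38587, -7145, -8628, 31267;
       -594275, -1128856, 1183957, 1128348, 174685, -198725, 105300;
       30656, 197742, -142616, -181203, -32685, 31267, -7145]]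

/-- The inverses of the matrices `unitMat`. -/
def unitInv : Fin 4 → Matrix (Fin 7) (Fin 7) ℤ :=
  ![
    !![3, 4, 3, 0, 0, -3, 0;
       3, 3, 4, 0, 0, -3, 0;
       3, 3, 3, 1, 0, -3, 0;
       1, 0, 0, -1, 0, 0, 0;
       -1, -1, -1, 0, 0, 1, 0;
       -10, -10, -10, 0, 0, 9, 1;
       0, 0, 0, 0, 1, 0, 0],
    !![-66986, -52396, -70963, -64173, -358182, -24753, 260256;
       -31302, -19889, -52396, -31543, -594891, 29655, 197730;
       -45769, -31302, -66986, -45606, -657417, 22344, 252138;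
       -45606, -31543, -64173, -46133, -603009, 15429, 244827;
       91494, 75795, 78501, 86752, 83114, 74161, -285049;
       -144659, -99447, -201904, -149573, -1895539, 40439, 784285;
       -135093, -132387, -32642, -119394, 1739236, -285049, 83114],
    !![3050102, 3203497, 3211236, 162051, -15243, -2887146, -152385;
       3042783, 3195704, 3203497, 162039, -13734, -2879592, -153525;
       2897169, 3042783, 3050102, 154312, -14874, -2741544, -145971;
       154312, 162039, 162051, 8644, -7320, -144462, -7923;
       -962505, -1011039, -1013177, -50795, 10464, 911207, 46217;
       -9143438, -9603218, -9628901, -483980, 2366, 8663208, 459326;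
       -53615, -55753, -55876, -5081, -478, 46217, 10464],
    !![-113567457442, 89403037680, -59412763677, 163264851463, -12363919404, -22999791057, 16863201372;
       170893845886, -134531751379, 89403037680, -245677406197, 18604957497, 34609586547, -25375379598;
       -217084117837, 170893845886, -113567457442, 312080652820, -23633623473, -43964084994, 32233998006;
       312080652820, -245677406197, 163264851463, -448647901319, 33975754131, 63202874907, -46339673535;
       -3910028996, 3078068983, -2045529895, 5621067124, -425679052, -791862847, 580585375;
       -154424824471, 121566940989, -80787276658, 222001501067, -16812000005, -31274264455, 22929956933;
       2866791511, -2256807367, 1499760656, -4121306468, 312103178, 580585375, -425679052]]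

lemma unitMat_mul_unitInv (i : Fin 4) : unitMat i * unitInv i = 1 := by
  revert i; decide +kernel

/-- Four multiplicatively independent units of `ℤ[α]`, as matrices. -/
def unitGL (i : Fin 4) : (Matrix (Fin 7) (Fin 7) ℤ)ˣ :=
  ⟨unitMat i, unitInv i, unitMat_mul_unitInv i, mul_eq_one_comm.mp (unitMat_mul_unitInv i)⟩

lemma commute_unitGL (i : Fin 4) : Commute (unitGL i).val Amat :=
  show unitMat i * Amat = Amat * unitMat i by revert i; decide +kernel

/-- Four multiplicatively independent units of `ℤ[α]`. -/
noncomputable def baseUnit (i : Fin 4) : OrderAˣ := commutantUnit (unitGL i) (commute_unitGL i)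

lemma unitClass_baseUnit (i : Fin 4) : unitClass (baseUnit i) = 1 := by
  have h : sgc2 (unitMat i) (unitInv i * Amat) = 0 := by revert i; decide +kernel
  rw [baseUnit, unitClass_commutantUnit, ← ofAdd_zero]
  exact congr_arg Multiplicative.ofAdd h

/-- The image in `ℤ/p` of the element of `ℤ[α]` represented by `U`, where `α ↦ r`. -/
def modEval (p : ℕ) (r : ZMod p) (U : Matrix (Fin 7) (Fin 7) ℤ) : ZMod p :=
  ∑ i : Fin 7, (((cyclicInv *ᵥ (U *ᵥ cyclicVec)) i : ℤ) : ZMod p) * r ^ (i : ℕ)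

lemma exists_character (p : ℕ) (hprime : p.Prime) (hp : p % 4 = 1) (r : ZMod p)
    (hr : r ^ 7 - 23 * r ^ 4 - 28 * r ^ 3 - 33 * r ^ 2 - 17 * r + 1 = 0) (k : Fin 4)
    (hk : modEval p r (unitMat k) ^ ((p - 1) / 2) = -1)
    (hl : ∀ l ≠ k, modEval p r (unitMat l) ^ ((p - 1) / 2) = 1) :
    ∃ χ : OrderAˣ →* (ZMod p)ˣ, χ (-1) = 1 ∧ (∀ u, χ u ^ 2 = 1) ∧ χ (baseUnit k) ≠ 1 ∧
      ∀ l ≠ k, χ (baseUnit l) = 1 := by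
  have : Fact p.Prime := ⟨hprime⟩
  let φ : OrderA →+* ZMod p := AdjoinRoot.lift (Int.castRingHom _) r (by rw [eval₂_charPolyA, hr])
  have hφ (i : Fin 4) : φ (baseUnit i).val = modEval p r (unitMat i) := by
    change φ (commutantElt (unitMat i)) = _
    simp [φ, commutantElt, orderElt, modEval]
  let χ : OrderAˣ →* (ZMod p)ˣ := (powMonoidHom ((p - 1) / 2)).comp (Units.map φ.toMonoidHom)
  have hχ (u : OrderAˣ) : (χ u).val = φ u.val ^ ((p - 1) / 2) := rfl
  refine ⟨χ, ?_, fun u => ?_, fun h => ?_, fun l hlk => ?_⟩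
  · ext
    rw [hχ, Units.val_neg, Units.val_one, map_neg, map_one, Even.neg_one_pow, Units.val_one]
    rw [Nat.even_iff]
    omega
  · ext
    rw [Units.val_pow_eq_pow_val, hχ, ← pow_mul, show (p - 1) / 2 * 2 = p - 1 by omega,
      ZMod.pow_card_sub_one_eq_one (u.isUnit.map φ).ne_zero, Units.val_one]
  · have h1 := congr_arg Units.val h
    rw [hχ, hφ, hk, Units.val_one] at h1
    have : Fact (2 < p) := ⟨by have := hprime.two_le; omega⟩
    exact ZMod.neg_one_ne_one h1
  · ext
    rw [hχ, hφ, hl l hlk, Units.val_one]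

lemma exists_separating_character (k : Fin 4) :
    ∃ (p : ℕ) (χ : OrderAˣ →* (ZMod p)ˣ), χ (-1) = 1 ∧ (∀ u, χ u ^ 2 = 1) ∧ χ (baseUnit k) ≠ 1 ∧
      ∀ l ≠ k, χ (baseUnit l) = 1 := by
  fin_cases k
  · exact ⟨293, exists_character 293 (by norm_num) rfl 259 rfl 0 (by decide +kernel)
      (by decide +kernel)⟩
  · exact ⟨17, exists_character 17 (by norm_num) rfl 4 rfl 1 (by decide +kernel)
      (by decide +kernel)⟩
  · exact ⟨457, exists_character 457 (by norm_num) rfl 219 rfl 2 (by decide +kernel)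
      (by decide +kernel)⟩
  · exact ⟨149, exists_character 149 (by norm_num) rfl 127 rfl 3 (by decide +kernel)
      (by decide +kernel)⟩

lemma unitClass_eq_one (u : OrderAˣ) : unitClass u = 1 := by
  by_contra hu
  let x : Fin 5 → OrderAˣ := Fin.cons u baseUnit
  obtain ⟨e, ⟨i, hi⟩, hrel⟩ := exists_relation_orderA le_rfl x
  have hprod {M : Type} [CommGroup M] (χ : OrderAˣ →* M) (hχ : χ (-1) = 1) :
      χ (∏ i, x i ^ e i) = 1 := by
    rcases hrel with h | h <;> simp [h, hχ]
  have h0 : Even (e 0) := by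
    refine even_exponent unitClass x e 0 (hprod _ unitClass_neg_one) ?_ hu fun j hj => ?_
    · have h (z : Multiplicative (ZMod 2)) : z ^ 2 = 1 := by revert z; decide
      exact h _
    · obtain ⟨k, rfl⟩ := Fin.exists_succ_eq.mpr hj
      simp [x, unitClass_baseUnit]
  refine hi ?_
  induction i using Fin.cases with
  | zero => exact h0
  | succ k =>
    obtain ⟨p, χ, hneg, hsq, hk, hl⟩ := exists_separating_character k
    refine even_exponent χ x e k.succ (hprod χ hneg) (hsq _) hk fun j hj => ?_
    induction j using Fin.cases with
    | zero =>
      obtain ⟨m, hm⟩ := h0.two_dvd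
      rw [hm, zpow_mul, map_zpow, map_zpow, zpow_ofNat, hsq, one_zpow]
    | succ l =>
      simp [x, hl l fun h => hj (congr_arg Fin.succ h)]

lemma sgc2_eq_zero_of_commute (U V : Matrix (Fin 7) (Fin 7) ℤ) (hUV : U * V = 1)
    (hU : Commute U Amat) : sgc2 U (V * Amat) = 0 :=
  Multiplicative.ofAdd.injective ((unitClass_commutantUnit
    ⟨U, V, hUV, mul_eq_one_comm.mp hUV⟩ hU).symm.trans (unitClass_eq_one _))

end UnitClasses

section FinalComputation

/-- An invertible matrix conjugating `Amat` to `Bmat`. -/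
def conjMat : Matrix (Fin 7) (Fin 7) ℤ :=
  !![1, 2, 2, 1, 0, 0, 0;
     1, 1, 2, 1, 0, 0, 0;
     1, 1, 1, 1, 0, 0, 0;
     1, 1, 1, 0, 0, 0, 0;
     0, 0, 0, 0, 1, 0, 0;
     0, 0, 0, 0, 0, 1, 0;
     0, 0, 0, 0, 0, 0, 1]

/-- The inverse of `conjMat`. -/
def conjInv : Matrix (Fin 7) (Fin 7) ℤ :=
  !![-1, 0, 1, 1, 0, 0, 0;
     1, -1, 0, 0, 0, 0, 0;
     0, 1, -1, 0, 0, 0, 0;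
     0, 0, 1, -1, 0, 0, 0;
     0, 0, 0, 0, 1, 0, 0;
     0, 0, 0, 0, 0, 1, 0;
     0, 0, 0, 0, 0, 0, 1]

lemma conjMat_mul_conjInv : conjMat * conjInv = 1 := by decide +kernel

lemma Amat_mul_conjMat : Amat * conjMat = conjMat * Bmat := by decide +kernel

lemma isUnit_Amat : IsUnit Amat := by
  have h : Amat * (17 + 33 * Amat + 28 * Amat ^ 2 + 23 * Amat ^ 3 - Amat ^ 6) = 1 := by
    decide +kernel
  exact .of_mul_eq_one _ h

lemma isUnit_Bmat : IsUnit Bmat := by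
  have h : Bmat * (17 + 33 * Bmat + 28 * Bmat ^ 2 + 23 * Bmat ^ 3 - Bmat ^ 6) = 1 := by
    decide +kernel
  exact .of_mul_eq_one _ h

lemma ConjWith.eq_one {x : ZMod 2} (h : ConjWith Amat Bmat x) : x = 1 := by
  obtain ⟨P, P', T, hP, hP', hA, hB, rfl⟩ := h
  have hinv : conjInv * conjMat = 1 := mul_eq_one_comm.mp conjMat_mul_conjInv
  have hAP : Amat * P = P * Bmat := by rw [hA, hB, Matrix.mul_assoc]
  have hU : P * conjInv * (conjMat * P') = 1 := by
    rw [Matrix.mul_assoc, ← Matrix.mul_assoc conjInv, hinv, Matrix.one_mul, hP]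
  have hcomm : Commute (P * conjInv) Amat := by
    have h1 : conjInv * Amat = Bmat * conjInv := by
      calc conjInv * Amat = conjInv * (Amat * conjMat) * conjInv := by
            rw [Matrix.mul_assoc, Matrix.mul_assoc Amat, conjMat_mul_conjInv, Matrix.mul_one]
        _ = Bmat * conjInv := by
            rw [Amat_mul_conjMat, ← Matrix.mul_assoc conjInv, hinv, Matrix.one_mul]
    change P * conjInv * Amat = Amat * (P * conjInv)
    rw [Matrix.mul_assoc, h1, ← Matrix.mul_assoc, ← hAP, Matrix.mul_assoc]
  have hT : T = P' * Amat := by rw [hA, ← Matrix.mul_assoc, hP', Matrix.one_mul]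
  have h0 : sgc2 conjMat (conjInv * Amat) = 1 := by decide +kernel
  have key := sgc2_cocycle (P * conjInv) conjMat T
  have e1 : conjMat * T = conjMat * P' * Amat := by rw [hT, Matrix.mul_assoc]
  have e2 : T * (P * conjInv) = conjInv * Amat := by
    rw [← Matrix.mul_assoc, ← hB, ← Matrix.one_mul Bmat, ← hinv, Matrix.mul_assoc conjInv,
      ← Amat_mul_conjMat, Matrix.mul_assoc, Matrix.mul_assoc, conjMat_mul_conjInv, Matrix.mul_one]
  have e3 : P * conjInv * conjMat = P := by rw [Matrix.mul_assoc, hinv, Matrix.mul_one]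
  rw [e1, e2, e3, sgc2_eq_zero_of_commute _ _ hU hcomm, h0, zero_add] at key
  exact key.symm

end FinalComputation

/-- The relative sign-gyration number of the pair `(A,B)` is `1`: every strong
shift equivalence over `ℤ` from `A` to `B` has total `sgc₂` equal to `1`. -/
theorem sum_sgc2_A_to_B_eq_one (k : ℕ) (c : SSEChain ℤ k) (hc : c.From Amat Bmat) :
    ∑ i : Fin k, sgc2 (c.R i) (c.S i) = 1 :=
  (hc.exists_conj isUnit_Amat isUnit_Bmat).eq_one
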